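/- For every h ∈ C(J̃,ℝ) and every m ≥ 1 one has ‖G^m h‖ ≤ ‖h‖; in particular G has operator norm 1 (G fixes the constant function 1). Moreover, either there exists m₀ such that ‖G^m h‖ < ‖h‖ for all m ≥ m₀, or ‖G^m h‖ = ‖h‖ for every m, and in the latter case h is a constant function. -/

import Mathlib

open MeasureTheory Filter Topology Polynomial
open scoped OnePoint Classical ENNReal

noncomputable section

namespace SkewRational

/-- The Riemann sphere, modelled as the one-point compactification of `ℂ`. -/
abbrev Sphere : Type := OnePoint ℂ

/-- The product space `X = Σ_N⁺ × ℂ̂`. -/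
abbrev SymX (N : ℕ) : Type := (ℕ → Fin N) × Sphere

variable {N : ℕ}

/-- The left shift on `Σ_N⁺`. -/
def shiftW (w : ℕ → Fin N) : ℕ → Fin N := fun n => w (n + 1)

/-- Prepending a letter to an infinite word. -/
def consW (v : Fin N) (w : ℕ → Fin N) : ℕ → Fin N := fun n => if n = 0 then v else w (n - 1)

/-- Evaluation of the rational map `P/Q` (in irreducible form) on the Riemann sphere. -/
def ratEval (P Q : ℂ[X]) : Sphere → Sphere := fun z =>
  OnePoint.elim z
    (if Q.natDegree < P.natDegree then (OnePoint.infty : Sphere)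
     else if P.natDegree < Q.natDegree then ((0 : ℂ) : Sphere)
     else ((P.leadingCoeff / Q.leadingCoeff : ℂ) : Sphere))
    (fun a => if Q.eval a = 0 then (OnePoint.infty : Sphere) else ((P.eval a / Q.eval a : ℂ) : Sphere))

/-- The multiset of preimages (with multiplicity) of a point of the sphere under `P/Q`. -/
def fiber (P Q : ℂ[X]) (a : Sphere) : Multiset Sphere :=
  OnePoint.elim a
    ((Q.roots.map fun z => (z : Sphere)) +
      Multiset.replicate (max P.natDegree Q.natDegree - Q.natDegree) (OnePoint.infty : Sphere))
    (fun b =>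
      (((P - Polynomial.C b * Q).roots.map fun z => (z : Sphere)) +
        Multiset.replicate
          (max P.natDegree Q.natDegree - (P - Polynomial.C b * Q).natDegree) (OnePoint.infty : Sphere)))

variable (p q : Fin N → ℂ[X])

/-- The degree `d_i` of the rational map `R_i = p i / q i`. -/
def degR (i : Fin N) : ℕ := max (p i).natDegree (q i).natDegree

/-- `D = d₁ + ⋯ + d_N`. -/
def Dtot : ℕ := ∑ i, degR p q i

/-- Standing assumptions: `N ≥ 1`, each `R_i = p i / q i` in irreducible form, all degrees
at least `1`, and at least one degree at least `2`. -/
def Good : Prop :=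
  1 ≤ N ∧ (∀ i, IsCoprime (p i) (q i)) ∧ (∀ i, 1 ≤ degR p q i) ∧ (∃ i, 2 ≤ degR p q i)

/-- The skew-product map `T(w, z) = (σ w, R_{w 0} z)`. -/
def Tmap : SymX N → SymX N := fun x => (shiftW x.1, ratEval (p (x.1 0)) (q (x.1 0)) x.2)

/-- The multiset of preimages of a point under `T`, counted with multiplicity. -/
def preimT (x : SymX N) : Multiset (SymX N) :=
  ∑ v : Fin N, (fiber (p v) (q v) x.2).map fun z => (consW v x.1, z)

/-- The multiset of `n`-th order preimages under `T^n`, counted with multiplicity. -/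
def preimTn : ℕ → SymX N → Multiset (SymX N)
  | 0, x => {x}
  | n + 1, x => (preimT p q x).bind fun y => preimTn n y

/-- The chordal (spherical) metric on the Riemann sphere. -/
def sphDist : Sphere → Sphere → ℝ := fun z w =>
  OnePoint.elim z
    (OnePoint.elim w 0 fun b => 2 / Real.sqrt (1 + ‖b‖ ^ 2))
    (fun a =>
      OnePoint.elim w (2 / Real.sqrt (1 + ‖a‖ ^ 2))
        (fun b => 2 * dist a b / (Real.sqrt (1 + ‖a‖ ^ 2) * Real.sqrt (1 + ‖b‖ ^ 2))))

/-- The metric `d(w, w') = 2^{-n(w,w')}` on `Σ_N⁺`. -/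
def shiftDist (w w' : ℕ → Fin N) : ℝ :=
  if h : ∃ n, w n ≠ w' n then (2 : ℝ)⁻¹ ^ (Nat.find h + 1) else 0

/-- The metric on `X`: maximum of the two coordinate metrics. -/
def dX : SymX N → SymX N → ℝ := fun x y => max (shiftDist x.1 y.1) (sphDist x.2 y.2)

/-- Montel normality of a family of self-maps of the sphere on a set `U`. -/
def NormalOn (F : Set (Sphere → Sphere)) (U : Set Sphere) : Prop :=
  ∀ s : ℕ → Sphere → Sphere, (∀ n, s n ∈ F) →
    ∃ φ : ℕ → ℕ, StrictMono φ ∧ ∃ g : Sphere → Sphere,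
      ∀ K : Set Sphere, K ⊆ U → IsCompact K → ∀ ε : ℝ, 0 < ε →
        ∀ᶠ n in atTop, ∀ z ∈ K, sphDist (s (φ n) z) (g z) < ε

/-- The compositions `R_{w (n-1)} ∘ ⋯ ∘ R_{w 0}`. -/
def itComp (w : ℕ → Fin N) : ℕ → Sphere → Sphere
  | 0 => id
  | n + 1 => ratEval (p (w n)) (q (w n)) ∘ itComp w n

/-- The fibrewise Fatou set `F_w`. -/
def fatouW (w : ℕ → Fin N) : Set Sphere :=
  {z | ∃ U : Set Sphere, IsOpen U ∧ z ∈ U ∧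
    NormalOn {g | ∃ n, 1 ≤ n ∧ g = itComp p q w n} U}

/-- The fibrewise Julia set `J_w`. -/
def juliaW (w : ℕ → Fin N) : Set Sphere := (fatouW p q w)ᶜ

/-- The Julia set `J̃` of the skew-product map `T`. -/
def juliaSet : Set (SymX N) :=
  closure (⋃ w : ℕ → Fin N, {w} ×ˢ juliaW p q w)

/-- The critical points of `T`: `(w, z)` with `z` a critical point of `R_{w 0}`. -/
def critSet : Set (SymX N) :=
  {x | 2 ≤ (fiber (p (x.1 0)) (q (x.1 0))
        (ratEval (p (x.1 0)) (q (x.1 0)) x.2)).count x.2}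

/-- Assumption (A1): no super-attracting periodic point of `T` lies in the Julia set
(a periodic point is super-attracting exactly when its orbit meets the critical set,
i.e. the derivative of the return composition vanishes). -/
def NoSuperAttract : Prop :=
  ∀ x ∈ juliaSet p q, ∀ m : ℕ, 1 ≤ m → (Tmap p q)^[m] x = x →
    ∀ k < m, (Tmap p q)^[k] x ∉ critSet p q

instance : MeasurableSpace (SymX N) := borel _
instance : BorelSpace (SymX N) := ⟨rfl⟩

instance : MeasurableSpace ↥(juliaSet p q) := borel _
instance : BorelSpace ↥(juliaSet p q) := ⟨rfl⟩

/-! ### Fixed points counted with multiplicity -/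

/-- Formal composition of rational maps as pairs of polynomials: `compPair a b = a ∘ b`. -/
def compPair (a b : ℂ[X] × ℂ[X]) : ℂ[X] × ℂ[X] :=
  (∑ i ∈ Finset.range (max a.1.natDegree a.2.natDegree + 1),
      Polynomial.C (a.1.coeff i) * b.1 ^ i * b.2 ^ (max a.1.natDegree a.2.natDegree - i),
   ∑ i ∈ Finset.range (max a.1.natDegree a.2.natDegree + 1),
      Polynomial.C (a.2.coeff i) * b.1 ^ i * b.2 ^ (max a.1.natDegree a.2.natDegree - i))

/-- For a word `[v₁, …, v_m]`, the composite `R_{v_m} ∘ ⋯ ∘ R_{v₁}` as a pair of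
polynomials. -/
def wordPair : List (Fin N) → ℂ[X] × ℂ[X]
  | [] => (Polynomial.X, 1)
  | v :: t => compPair (wordPair t) (p v, q v)

/-- The multiset of fixed points (with multiplicity) on the sphere of the rational map given
by a pair of polynomials; a degree-`k` map has `k + 1` fixed points with multiplicity. -/
def fixMul (a : ℂ[X] × ℂ[X]) : Multiset Sphere :=
  ((a.1 - Polynomial.X * a.2).roots.map fun z => (z : Sphere)) +
    Multiset.replicate
      (max a.1.natDegree a.2.natDegree + 1 - (a.1 - Polynomial.X * a.2).natDegree) (OnePoint.infty : Sphere)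

/-- The periodic word `(v₁ ⋯ v_m v₁ ⋯ v_m ⋯)`. -/
def perW {m : ℕ} (hm : 0 < m) (v : Fin m → Fin N) : ℕ → Fin N :=
  fun n => v ⟨n % m, Nat.mod_lt n hm⟩

/-- The multiset `Fix_m(T)` of fixed points of `T^m`, counted with multiplicity. -/
def fixMultiset (m : ℕ) : Multiset (SymX N) :=
  if hm : 0 < m then
    ∑ v : Fin m → Fin N, (fixMul (wordPair p q (List.ofFn v))).map fun z => (perW hm v, z)
  else 0

/-! ### Thermodynamic formalism -/

/-- The ergodic (Birkhoff) sum `f^n`. -/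
def birk (f : SymX N → ℝ) (n : ℕ) (y : SymX N) : ℝ :=
  ∑ k ∈ Finset.range n, f ((Tmap p q)^[k] y)

/-- `(L_f^n 1)(x) = Σ_{T^n y = x} e^{f^n(y)}`. -/
def LSum (f : SymX N → ℝ) (n : ℕ) (x : SymX N) : ℝ :=
  ((preimTn p q n x).map fun y => Real.exp (birk p q f n y)).sum

/-- The pressure `P(f) = sup_{x ∈ J̃} limsup (1/n) log (L_f^n 1)(x)`. -/
def pressure (f : SymX N → ℝ) : ℝ :=
  ⨆ x : ↥(juliaSet p q), limsup (fun n : ℕ => (n : ℝ)⁻¹ * Real.log (LSum p q f n ↑x)) atTop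

/-- Extension by zero of a function on `J̃` to all of `X`; since `T⁻¹ J̃ = J̃`, the values
outside `J̃` are irrelevant in all expressions below. -/
def jextend (f : ↥(juliaSet p q) → ℝ) : SymX N → ℝ :=
  fun x => if hx : x ∈ juliaSet p q then f ⟨x, hx⟩ else 0

/-- Hölder continuity on `J̃` with respect to the metric `d_X`. -/
def HolderOnJ (f : ↥(juliaSet p q) → ℝ) : Prop :=
  ∃ C : ℝ, 0 < C ∧ ∃ α : ℝ, α ∈ Set.Ioc (0 : ℝ) 1 ∧
    ∀ x y : ↥(juliaSet p q), |f x - f y| ≤ C * dX (x : SymX N) (y : SymX N) ^ α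

/-- `Q(g) = P(f + g) − P(f)`. -/
def Qfun (f g : ↥(juliaSet p q) → ℝ) : ℝ :=
  pressure p q (jextend p q fun x => f x + g x) - pressure p q (jextend p q f)

/-- The Legendre transform `L(m) = sup_g (∫ g dm − Q(g)) ∈ [0, (OnePoint.infty : Sphere)]`. -/
def LLfun (f : ↥(juliaSet p q) → ℝ) (m : ProbabilityMeasure ↥(juliaSet p q)) : EReal :=
  ⨆ g : C(↥(juliaSet p q), ℝ),
    (((∫ x, g x ∂(m : Measure ↥(juliaSet p q))) - Qfun p q f g : ℝ) : EReal)

/-- `ρ(K) = inf_{m ∈ K} L(m)`. -/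
def rho (f : ↥(juliaSet p q) → ℝ) (K : Set (ProbabilityMeasure ↥(juliaSet p q))) : EReal :=
  ⨅ m ∈ K, LLfun p q f m

/-- Membership in `M_T`: `T`-invariance of a probability measure on `J̃`. -/
def MTinv (m : ProbabilityMeasure ↥(juliaSet p q)) : Prop :=
  ∀ A : Set (SymX N), MeasurableSet A →
    ((m : Measure ↥(juliaSet p q)).map Subtype.val) (Tmap p q ⁻¹' A) =
      ((m : Measure ↥(juliaSet p q)).map Subtype.val) A

/-- The orbital measure `μ_{y,n} = (1/n)(δ_y + δ_{Ty} + ⋯ + δ_{T^{n-1}y})`, viewed as a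
measure on `J̃`. -/
def orbMeas (y : SymX N) (n : ℕ) : Measure ↥(juliaSet p q) :=
  Measure.comap Subtype.val
    ((n : ℝ≥0∞)⁻¹ • ∑ k ∈ Finset.range n, Measure.dirac ((Tmap p q)^[k] y))

/-- The (unique, if it exists) probability-measure avatar of `μ` lies in `K`. -/
def inK (μ : Measure ↥(juliaSet p q)) (K : Set (ProbabilityMeasure ↥(juliaSet p q))) : Prop :=
  ∃ ν : ProbabilityMeasure ↥(juliaSet p q), (ν : Measure ↥(juliaSet p q)) = μ ∧ ν ∈ K

/-- The sequence `(1/n) log [Σ_{T^n y = x, μ_{y,n} ∈ K} e^{f^n(y)} / Σ_{T^n y = x} e^{f^n(y)}]`,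
valued in `EReal` with the convention `log 0 = ⊥`. -/
def preimLDSeq (f : ↥(juliaSet p q) → ℝ) (x : SymX N)
    (K : Set (ProbabilityMeasure ↥(juliaSet p q))) : ℕ → EReal := fun n =>
  if (((preimTn p q n x).filter fun y => inK p q (orbMeas p q y n) K).map
        fun y => Real.exp (birk p q (jextend p q f) n y)).sum = 0 then ⊥
  else
    (((n : ℝ)⁻¹ * Real.log
      (((((preimTn p q n x).filter fun y => inK p q (orbMeas p q y n) K).map
          fun y => Real.exp (birk p q (jextend p q f) n y)).sum) /
        LSum p q (jextend p q f) n x) : ℝ) : EReal)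

/-- `Fix_m(T) ∩ J̃` as a multiset. -/
def fixJ (m : ℕ) : Multiset (SymX N) := (fixMultiset p q m).filter fun y => y ∈ juliaSet p q

/-- `Σ_{(ω,ζ) ∈ Fix_m(T) ∩ J̃} e^{f^m(ω,ζ)}`. -/
def fixSum (f : SymX N → ℝ) (m : ℕ) : ℝ :=
  ((fixJ p q m).map fun y => Real.exp (birk p q f m y)).sum

/-- The periodic-point analogue of `preimLDSeq`, with the convention `log 0 = ⊥`. -/
def fixLDSeq (f : ↥(juliaSet p q) → ℝ)
    (K : Set (ProbabilityMeasure ↥(juliaSet p q))) : ℕ → EReal := fun m =>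
  if (((fixJ p q m).filter fun y => inK p q (orbMeas p q y m) K).map
        fun y => Real.exp (birk p q (jextend p q f) m y)).sum = 0 then ⊥
  else
    (((m : ℝ)⁻¹ * Real.log
      (((((fixJ p q m).filter fun y => inK p q (orbMeas p q y m) K).map
          fun y => Real.exp (birk p q (jextend p q f) m y)).sum) /
        fixSum p q (jextend p q f) m) : ℝ) : EReal)

/-! ### Inverse branches -/

/-- Projection of a subset of `X` to the sphere coordinate. -/
def projC (E : Set (SymX N)) : Set Sphere := Prod.snd '' E

/-- For a word `[v₁, …, v_m]`, the composite map `R_{v₁} ∘ R_{v₂} ∘ ⋯ ∘ R_{v_m}`. -/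
def mapWord (l : List (Fin N)) : Sphere → Sphere :=
  l.foldr (fun i f => ratEval (p i) (q i) ∘ f) id

/-- `γ_m(U)`: the total number of analytic inverse branches of `T^m` on `U`, counted over
all `m`-strings.  (A continuous section of a rational map off its critical values is
automatically holomorphic.) -/
def gammaCount (U : Set (SymX N)) (m : ℕ) : ℕ :=
  Nat.card ((v : Fin m → Fin N) ×
    { s : C(↥(projC U), Sphere) // ∀ z : ↥(projC U), mapWord p q (List.ofFn v) (s z) = ↑z })

/-- `C_n = ⋃_{k=1}^n T^k(C)`, the critical values of `T` of order up to `n`. -/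
def critValSet (n : ℕ) : Set (SymX N) :=
  ⋃ k ∈ Finset.Icc 1 n, (Tmap p q)^[k] '' critSet p q

/-- `τ`: the number of distinct critical values of `T` in `U` (projected to the sphere). -/
def tauCount (U : Set (SymX N)) : ℕ := (Prod.snd '' (Tmap p q '' critSet p q ∩ U)).ncard

/-! ### The averaging operator `G` -/

/-- `(G^m h)(x) = D^{-m} Σ_{T^m y = x} h(y)`. -/
def GmFun (h : SymX N → ℝ) (m : ℕ) (x : SymX N) : ℝ :=
  ((Dtot p q : ℝ) ^ m)⁻¹ * ((preimTn p q m x).map h).sum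

/-- The supremum norm on functions on `J̃`. -/
def supJ (f : ↥(juliaSet p q) → ℝ) : ℝ := ⨆ x, |f x|


theorem exists_log_ball {c : ℂ} {r : ℝ} (hr : 0 < r) {f : ℂ → ℂ}
    (hf : DifferentiableOn ℂ f (Metric.ball c r)) (h0 : ∀ z ∈ Metric.ball c r, f z ≠ 0) :
    ∃ l : ℂ → ℂ, DifferentiableOn ℂ l (Metric.ball c r) ∧
      ∀ z ∈ Metric.ball c r, f z = Complex.exp (l z) := by
  have hd : DifferentiableOn ℂ (fun z => deriv f z / f z) (Metric.ball c r) :=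
    (hf.deriv Metric.isOpen_ball).div hf h0
  obtain ⟨g, hg⟩ := hd.isExactOn_ball
  have hgd : DifferentiableOn ℂ g (Metric.ball c r) :=
    fun z hz => (hg z hz).differentiableAt.differentiableWithinAt
  have hc : c ∈ Metric.ball c r := Metric.mem_ball_self hr
  have key : ∀ z ∈ Metric.ball c r, f z * Complex.exp (-g z) = f c * Complex.exp (-g c) := by
    intro z hz
    have hD : ∀ z ∈ Metric.ball c r, HasDerivAt (fun z => f z * Complex.exp (-g z)) 0 z := by
      intro z hz
      have h1 : HasDerivAt f (deriv f z) z :=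
        (hf.differentiableAt (Metric.isOpen_ball.mem_nhds hz)).hasDerivAt
      have h2 := h1.mul ((hg z hz).neg.cexp)
      refine h2.congr_deriv ?_
      have := h0 z hz
      have e : deriv f z = f z * (deriv f z / f z) := by field_simp
      simp only [Pi.neg_apply]
      linear_combination (Complex.exp (-g z)) * e
    exact (convex_ball c r).is_const_of_fderivWithin_eq_zero (𝕜 := ℂ)
      (fun z hz => (hD z hz).differentiableAt.differentiableWithinAt)
      (fun z hz => by
        rw [fderivWithin_of_isOpen Metric.isOpen_ball hz]
        have := (hD z hz).hasFDerivAt.fderiv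
        rw [this]; ext; simp) hz hc
  have hne : f c * Complex.exp (-g c) ≠ 0 := mul_ne_zero (h0 c hc) (Complex.exp_ne_zero _)
  refine ⟨fun z => g z + Complex.log (f c * Complex.exp (-g c)), hgd.add_const _, fun z hz => ?_⟩
  rw [Complex.exp_add, Complex.exp_log hne, ← key z hz, mul_comm (f z), ← mul_assoc,
    ← Complex.exp_add]
  simp

/-- holomorphic arccos on a ball with control at the centre -/
theorem exists_arccos_ball {c : ℂ} {r : ℝ} (hr : 0 < r) {f : ℂ → ℂ}
    (hf : DifferentiableOn ℂ f (Metric.ball c r)) (h1 : ∀ z ∈ Metric.ball c r, f z ≠ 1)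
    (h2 : ∀ z ∈ Metric.ball c r, f z ≠ -1) (hc3 : ‖f c‖ ≤ 3) :
    ∃ a : ℂ → ℂ, DifferentiableOn ℂ a (Metric.ball c r) ∧
      (∀ z ∈ Metric.ball c r, f z = Complex.cos (Real.pi * a z)) ∧ ‖a c‖ ≤ 3 := by
  have hc : c ∈ Metric.ball c r := Metric.mem_ball_self hr
  have hd : DifferentiableOn ℂ (fun z => f z ^ 2 - 1) (Metric.ball c r) := (hf.pow 2).sub_const 1
  obtain ⟨l, hl, hle⟩ := exists_log_ball hr hd (fun z hz h => by
    have : (f z - 1) * (f z + 1) = 0 := by linear_combination h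
    rcases mul_eq_zero.1 this with h | h
    · exact h1 z hz (sub_eq_zero.1 h)
    · exact h2 z hz (eq_neg_of_add_eq_zero_left h))
  set s : ℂ → ℂ := fun z => Complex.exp (l z / 2) with hs
  have hsd : DifferentiableOn ℂ s (Metric.ball c r) := (hl.div_const 2).cexp
  have hs2 : ∀ z ∈ Metric.ball c r, s z ^ 2 = f z ^ 2 - 1 := by
    intro z hz
    have := hle z hz
    rw [this, hs, ← Complex.exp_nat_mul]
    congr 1; push_cast; ring
  have hprod : ∀ z ∈ Metric.ball c r, (f z + s z) * (f z - s z) = 1 := by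
    intro z hz; linear_combination - hs2 z hz
  obtain ⟨b, hb, hbe⟩ := exists_log_ball hr (hf.add hsd) (fun z hz h => by
    have := hprod z hz
    simp only [Pi.add_apply] at h
    rw [h, zero_mul] at this; exact zero_ne_one this)
  -- bounds
  have hsn : ‖s c‖ ≤ 4 := by
    have : ‖s c‖ ^ 2 ≤ 10 := by
      rw [← norm_pow, hs2 c hc]
      calc ‖f c ^ 2 - 1‖ ≤ ‖f c ^ 2‖ + ‖(1:ℂ)‖ := norm_sub_le _ _
        _ = ‖f c‖^2 + 1 := by simp
        _ ≤ 10 := by nlinarith [norm_nonneg (f c)]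
    nlinarith [norm_nonneg (s c)]
  have hup : ‖f c + s c‖ ≤ 7 := (norm_add_le _ _).trans (by linarith)
  have hum : ‖f c - s c‖ ≤ 7 := (norm_sub_le _ _).trans (by linarith)
  have hbre : Real.exp (b c).re = ‖f c + s c‖ := by
    have := hbe c hc
    simp only [Pi.add_apply] at this
    rw [this, Complex.norm_exp]
  have hbren : Real.exp (-(b c).re) = ‖f c - s c‖ := by
    rw [Real.exp_neg, hbre]
    have := congrArg norm (hprod c hc)
    rw [norm_mul, norm_one] at this
    exact (eq_inv_of_mul_eq_one_right this).symm
  have h7 : (7:ℝ) ≤ Real.exp 2 := by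
    have := Real.exp_one_gt_d9
    have h : Real.exp 2 = Real.exp 1 * Real.exp 1 := by rw [← Real.exp_add]; norm_num
    rw [h]; nlinarith
  have hb1 : (b c).re ≤ 2 := Real.exp_le_exp.1 (by rw [hbre]; linarith)
  have hb2 : -(b c).re ≤ 2 := Real.exp_le_exp.1 (by rw [hbren]; linarith)
  have hpi := Real.pi_gt_three
  have hpi0 : (Real.pi : ℂ) ≠ 0 := by exact_mod_cast Real.pi_ne_zero
  set n : ℤ := round ((b c).im / (2 * Real.pi)) with hn
  have hround : |(b c).im / (2 * Real.pi) - n| ≤ 1/2 := abs_sub_round _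
  refine ⟨fun z => (b z - 2 * Real.pi * n * Complex.I) / (Real.pi * Complex.I),
    (hb.sub_const _).div_const _, fun z hz => ?_, ?_⟩
  · have e1 : Complex.exp (b z) = f z + s z := (hbe z hz).symm
    have e2 : Complex.exp (-b z) = f z - s z := by
      rw [Complex.exp_neg, e1]
      exact (eq_inv_of_mul_eq_one_right (hprod z hz)).symm
    have : (Real.pi : ℂ) * ((b z - 2 * Real.pi * n * Complex.I) / (Real.pi * Complex.I))
        = (-(b z * Complex.I)) - n * (2 * Real.pi) := by
      field_simp
      linear_combination (b z) * Complex.I_sq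
    rw [this, Complex.cos_sub_int_mul_two_pi, Complex.cos_neg, Complex.cos]
    have i1 : b z * Complex.I * Complex.I = - b z := by linear_combination b z * Complex.I_sq
    have i2 : -(b z * Complex.I) * Complex.I = b z := by linear_combination - b z * Complex.I_sq
    rw [i1, i2, e1, e2]; ring
  · simp only [norm_div, norm_mul, Complex.norm_I, mul_one, Complex.norm_real, Real.norm_eq_abs,
      abs_of_pos Real.pi_pos]
    rw [div_le_iff₀ Real.pi_pos]
    refine (Complex.norm_le_abs_re_add_abs_im _).trans ?_
    have hre : (b c - 2 * Real.pi * n * Complex.I).re = (b c).re := by simp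
    have him : (b c - 2 * Real.pi * n * Complex.I).im = (b c).im - 2 * Real.pi * n := by simp
    rw [hre, him]
    have : |(b c).im - 2 * Real.pi * n| ≤ Real.pi := by
      have e : (b c).im - 2 * Real.pi * n = ((b c).im / (2 * Real.pi) - n) * (2 * Real.pi) := by
        field_simp
      rw [e, abs_mul, abs_of_pos (by positivity : (0:ℝ) < 2 * Real.pi)]
      nlinarith
    have := abs_le.2 ⟨by linarith, hb1⟩
    linarith

theorem cos_int_pi (n : ℤ) : ∃ e : ℤ, (e = 1 ∨ e = -1) ∧ ∀ x : ℂ, Complex.cos (x + n * Real.pi) = e * Complex.cos x := by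
  rcases Int.even_or_odd' n with ⟨k, rfl | rfl⟩
  · refine ⟨1, Or.inl rfl, fun x => ?_⟩
    have : x + ((2 * k : ℤ) : ℂ) * Real.pi = x + k * (2 * Real.pi) := by push_cast; ring
    rw [this, Complex.cos_add_int_mul_two_pi]; simp
  · refine ⟨-1, Or.inr rfl, fun x => ?_⟩
    have : x + ((2 * k + 1 : ℤ) : ℂ) * Real.pi = (x + k * (2 * Real.pi)) + Real.pi := by push_cast; ring
    rw [this, Complex.cos_add_pi, Complex.cos_add_int_mul_two_pi]; simp

/-- every point is within distance 2 of a point with integral cosine -/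
theorem exists_int_cos (u : ℂ) : ∃ v : ℂ, dist v u ≤ 2 ∧ ∃ n : ℤ, Complex.cos (Real.pi * v) = n := by
  set m : ℤ := round u.re
  set Y := |u.im| with hY
  obtain ⟨y, hy1, hy2, n, hn⟩ : ∃ y : ℝ, Y ≤ y ∧ y ≤ Y + 1 ∧ ∃ n : ℤ, Real.cosh (Real.pi * y) = n := by
    have hcont : ContinuousOn (fun y : ℝ => Real.cosh (Real.pi * y)) (Set.Icc Y (Y+1)) := by
      fun_prop
    have hY0 : 0 ≤ Y := abs_nonneg _
    have hmem : ((⌈Real.cosh (Real.pi * Y)⌉ : ℤ) : ℝ) ∈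
        Set.Icc (Real.cosh (Real.pi * Y)) (Real.cosh (Real.pi * (Y + 1))) := by
      refine ⟨Int.le_ceil _, (Int.ceil_lt_add_one _).le.trans ?_⟩
      have h1 := Real.one_le_cosh (Real.pi * Y)
      have h2 : 2 ≤ Real.cosh Real.pi := by
        rw [Real.cosh_eq]
        have := Real.add_one_le_exp Real.pi
        have := Real.pi_gt_three
        have := Real.exp_pos (-Real.pi)
        linarith
      have h3 : 0 ≤ Real.sinh (Real.pi * Y) := Real.sinh_nonneg_iff.2 (by positivity)
      have h4 : 0 ≤ Real.sinh Real.pi := Real.sinh_nonneg_iff.2 Real.pi_pos.le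
      rw [mul_add, mul_one, Real.cosh_add]
      nlinarith [mul_nonneg h3 h4]
    obtain ⟨y, hy, hye⟩ := intermediate_value_Icc (by linarith) hcont hmem
    exact ⟨y, hy.1, hy.2, _, hye⟩
  obtain ⟨t, ht1, ht2⟩ : ∃ t : ℝ, |t - u.im| ≤ 1 ∧ Real.cosh (Real.pi * t) = n := by
    rcases le_total 0 u.im with h | h
    · rw [abs_of_nonneg h] at hY
      exact ⟨y, abs_le.2 ⟨by linarith, by linarith⟩, hn⟩
    · rw [abs_of_nonpos h] at hY
      exact ⟨-y, abs_le.2 ⟨by linarith, by linarith⟩, by rw [mul_neg, Real.cosh_neg, hn]⟩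
  obtain ⟨ε, -, hε⟩ := cos_int_pi m
  refine ⟨⟨m, t⟩, ?_, ε * n, ?_⟩
  · rw [dist_eq_norm]
    refine (Complex.norm_le_abs_re_add_abs_im _).trans ?_
    have : |(m:ℝ) - u.re| ≤ 1/2 := by rw [abs_sub_comm]; exact abs_sub_round _
    simp only [Complex.sub_re, Complex.sub_im]
    linarith
  · have e : (Real.pi : ℂ) * (⟨m, t⟩ : ℂ) = (Real.pi * t : ℝ) * Complex.I + m * Real.pi := by
      apply Complex.ext <;> simp <;> ring
    rw [e, hε, Complex.cos_mul_I, ← Complex.ofReal_cosh, ht2]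
    push_cast
    rfl

theorem bloch_aux {p : ℂ} {t : ℝ} (ht : 0 < t) {g : ℂ → ℂ}
    (hg : DifferentiableOn ℂ g (Metric.ball p t)) (hp : deriv g p ≠ 0)
    (hb : ∀ z ∈ Metric.ball p t, ‖deriv g z‖ ≤ 2 * ‖deriv g p‖) :
    Metric.ball (g p) (‖deriv g p‖ * t / 24) ⊆ g '' Metric.ball p t := by
  have hpp : p ∈ Metric.ball p t := Metric.mem_ball_self ht
  set A := ‖deriv g p‖ with hA
  have hA0 : 0 < A := norm_pos_iff.2 hp
  have hsub : Metric.closedBall p (t/6) ⊆ Metric.ball p t :=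
    Metric.closedBall_subset_ball (by linarith)
  have hd' := hg.deriv Metric.isOpen_ball
  have hmaps : Set.MapsTo (deriv g) (Metric.ball p t) (Metric.closedBall (deriv g p) (3 * A)) := by
    intro z hz
    rw [Metric.mem_closedBall, dist_eq_norm]
    refine (norm_sub_le _ _).trans ?_
    have := hb z hz
    linarith
  have hder : ∀ z ∈ Metric.closedBall p (t/6), ‖deriv g z - deriv g p‖ ≤ A / 2 := by
    intro z hz
    have := Complex.dist_le_div_mul_dist_of_mapsTo_ball hd' hmaps (hsub hz)
    rw [dist_eq_norm] at this
    refine this.trans ?_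
    have hz' := Metric.mem_closedBall.1 hz
    calc 3 * A / t * dist z p ≤ 3 * A / t * (t / 6) := by gcongr
      _ = A / 2 := by field_simp; ring
  have hlow : ∀ z ∈ Metric.sphere p (t/6), A * t / 12 ≤ ‖g z - g p‖ := by
    intro z hz
    have hzc : z ∈ Metric.closedBall p (t/6) := Metric.sphere_subset_closedBall hz
    have hpc : p ∈ Metric.closedBall p (t/6) := Metric.mem_closedBall_self (by linarith)
    have hmv := (convex_closedBall p (t/6)).norm_image_sub_le_of_norm_hasDerivWithin_le
      (f := fun z => g z - deriv g p * z) (f' := fun z => deriv g z - deriv g p) (C := A/2)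
      (fun z hz => by
        have h := ((hg.differentiableAt (Metric.isOpen_ball.mem_nhds (hsub hz))).hasDerivAt)
        have h2 := (hasDerivAt_id z).const_mul (deriv g p)
        have := (h.sub h2).hasDerivWithinAt (s := Metric.closedBall p (t/6))
        rw [mul_one] at this
        exact this) hder hpc hzc
    have hzn : ‖z - p‖ = t / 6 := by simpa [dist_eq_norm] using hz
    rw [hzn] at hmv
    have e : deriv g p * (z - p) = (g z - g p) - ((g z - deriv g p * z) - (g p - deriv g p * p)) := by
      ring
    have h1 : A * (t/6) ≤ ‖g z - g p‖ + A / 2 * (t / 6) := by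
      calc A * (t/6) = ‖deriv g p * (z - p)‖ := by rw [norm_mul, hzn]
        _ ≤ _ := by rw [e]; exact (norm_sub_le _ _).trans (by gcongr)
    linarith
  have hfreq : ∃ᶠ z in 𝓝 p, g z ≠ g p := by
    have h := ((hg.differentiableAt (Metric.isOpen_ball.mem_nhds hpp)).hasDerivAt).eventually_ne (c := g p) hp
    exact (h.frequently).filter_mono nhdsWithin_le_nhds
  have hdc : DiffContOnCl ℂ g (Metric.ball p (t/6)) := by
    apply DifferentiableOn.diffContOnCl
    rw [closure_ball _ (by linarith)]
    exact hg.mono hsub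
  have := hdc.ball_subset_image_closedBall (by linarith) hlow hfreq
  have e : A * t / 12 / 2 = A * t / 24 := by ring
  rw [e] at this
  exact this.trans (Set.image_mono hsub)

/-- Bloch: if the image contains no ball of radius 3, derivative bound. -/
theorem bloch {c : ℂ} {r : ℝ} (hr : 0 < r) {g : ℂ → ℂ}
    (hg : DifferentiableOn ℂ g (Metric.ball c r))
    (hno : ∀ u : ℂ, ¬ Metric.ball u 3 ⊆ g '' Metric.ball c r) :
    ‖deriv g c‖ * r ≤ 288 := by
  set ρ := r / 2 with hρ
  have hρ0 : 0 < ρ := by positivity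
  have hsub : Metric.closedBall c ρ ⊆ Metric.ball c r := Metric.closedBall_subset_ball (by linarith)
  have hd' := hg.deriv Metric.isOpen_ball
  have hcont : ContinuousOn (fun z => ‖deriv g z‖ * (ρ - dist z c)) (Metric.closedBall c ρ) := by
    have := (hd'.continuousOn).mono hsub
    fun_prop
  obtain ⟨p, hp, hmax⟩ := (isCompact_closedBall c ρ).exists_isMaxOn
    ⟨c, Metric.mem_closedBall_self hρ0.le⟩ hcont
  have hmc := hmax (Metric.mem_closedBall_self hρ0.le)
  simp only [Set.mem_ofPred_eq, dist_self, sub_zero] at hmc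
  by_cases h0 : ‖deriv g p‖ * (ρ - dist p c) ≤ 0
  · nlinarith
  push Not at h0
  have hρp : 0 ≤ ρ - dist p c := by have := Metric.mem_closedBall.1 hp; linarith
  have hρp' : 0 < ρ - dist p c := by
    rcases hρp.eq_or_lt with h | h
    · rw [← h] at h0; simp at h0
    · exact h
  have hgp : 0 < ‖deriv g p‖ := by
    by_contra h
    have : ‖deriv g p‖ = 0 := le_antisymm (not_lt.1 h) (norm_nonneg _)
    rw [this] at h0; simp at h0
  set t := (ρ - dist p c) / 2 with ht
  have ht0 : 0 < t := by positivity
  have hballs : Metric.ball p t ⊆ Metric.closedBall c ρ := by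
    intro z hz
    have := dist_triangle z p c
    have := Metric.mem_ball.1 hz
    rw [Metric.mem_closedBall]; linarith
  have hb : ∀ z ∈ Metric.ball p t, ‖deriv g z‖ ≤ 2 * ‖deriv g p‖ := by
    intro z hz
    have h1 := hmax (hballs hz)
    simp only [Set.mem_ofPred_eq] at h1
    have h2 : t ≤ ρ - dist z c := by
      have := dist_triangle z p c
      have := Metric.mem_ball.1 hz
      linarith
    have h3 : ‖deriv g z‖ * t ≤ ‖deriv g p‖ * (2 * t) := by
      calc _ ≤ ‖deriv g z‖ * (ρ - dist z c) := by gcongr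
        _ ≤ _ := h1.trans (by rw [ht]; apply le_of_eq; ring)
    nlinarith
  have hincl := bloch_aux ht0 (hg.mono (hballs.trans hsub)) (norm_pos_iff.1 hgp) hb
  have hle : ‖deriv g p‖ * t / 24 < 3 := by
    by_contra h
    push Not at h
    exact hno _ ((Metric.ball_subset_ball h).trans
      (hincl.trans (Set.image_mono (hballs.trans hsub))))
  have : ‖deriv g c‖ * ρ ≤ 144 := hmc.trans (by
    have : ρ - dist p c = 2 * t := by rw [ht]; ring
    rw [this]; linarith)
  rw [hρ] at this; linarith

/-- Schottky -/
theorem schottky : ∃ S : ℝ, 0 < S ∧ ∀ (c : ℂ) (r : ℝ) (f : ℂ → ℂ), 0 < r →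
    DifferentiableOn ℂ f (Metric.ball c r) → (∀ z ∈ Metric.ball c r, f z ≠ 0) →
    (∀ z ∈ Metric.ball c r, f z ≠ 1) → ‖f c‖ ≤ 1 → ∀ z ∈ Metric.ball c (r/2), ‖f z‖ ≤ S := by
  refine ⟨1 + Real.exp (Real.pi * Real.exp (Real.pi * 291)), by positivity, ?_⟩
  intro c r f hr hf h0 h1 hfc z hz
  have hc : c ∈ Metric.ball c r := Metric.mem_ball_self hr
  obtain ⟨a, ha, hae, hac⟩ := exists_arccos_ball hr (f := fun z => 2 * f z - 1)
    ((hf.const_mul 2).sub_const 1) (fun z hz h => h1 z hz (by linear_combination h / 2))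
    (fun z hz h => h0 z hz (by linear_combination h / 2)) (by
      refine (norm_sub_le _ _).trans ?_
      simp; linarith)
  have haint : ∀ z ∈ Metric.ball c r, ∀ n : ℤ, a z ≠ n := by
    intro z hz n hn
    have e := hae z hz
    obtain ⟨ε, hε, hcs⟩ := cos_int_pi n
    rw [hn, mul_comm (Real.pi : ℂ), ← zero_add ((n:ℂ) * Real.pi), hcs, Complex.cos_zero, mul_one] at e
    rcases hε with rfl | rfl
    · push_cast at e; exact h1 z hz (by linear_combination e / 2)
    · push_cast at e; exact h0 z hz (by linear_combination e / 2)
  obtain ⟨g, hg, hge, hgc⟩ := exists_arccos_ball hr ha (fun z hz => by exact_mod_cast haint z hz 1)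
    (fun z hz => by exact_mod_cast haint z hz (-1)) hac
  have hno : ∀ u : ℂ, ¬ Metric.ball u 3 ⊆ g '' Metric.ball c r := by
    intro u hu
    obtain ⟨v, hv, n, hn⟩ := exists_int_cos u
    obtain ⟨y, hy, rfl⟩ := hu (Metric.mem_ball.2 (lt_of_le_of_lt hv (by norm_num)))
    exact haint y hy n (by rw [hge y hy, hn])
  have hder : ∀ y ∈ Metric.ball c (r/2), ‖deriv g y‖ ≤ 576 / r := by
    intro y hy
    have hsub : Metric.ball y (r/2) ⊆ Metric.ball c r := by
      apply Metric.ball_subset_ball'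
      have := Metric.mem_ball.1 hy; linarith
    have := bloch (r := r/2) (by linarith) (hg.mono hsub)
      (fun u hu => hno u (hu.trans (Set.image_mono hsub)))
    rw [le_div_iff₀ hr]; linarith
  have hsub2 : Metric.ball c (r/2) ⊆ Metric.ball c r := Metric.ball_subset_ball (by linarith)
  have hgz : ‖g z‖ ≤ 291 := by
    have := (convex_ball c (r/2)).norm_image_sub_le_of_norm_deriv_le (f := g) (C := 576 / r)
      (fun y hy => hg.differentiableAt (Metric.isOpen_ball.mem_nhds (hsub2 hy))) hder
      (Metric.mem_ball_self (by linarith)) hz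
    have hzn : ‖z - c‖ ≤ r / 2 := by rw [← dist_eq_norm]; exact (Metric.mem_ball.1 hz).le
    have h2 : ‖g z - g c‖ ≤ 288 := this.trans (by
      calc 576 / r * ‖z - c‖ ≤ 576 / r * (r/2) := by gcongr
        _ = 288 := by field_simp; norm_num)
    have e : g z = (g z - g c) + g c := by ring
    rw [e]; exact (norm_add_le _ _).trans (by linarith)
  have hcos : ∀ w : ℂ, ‖Complex.cos w‖ ≤ Real.exp ‖w‖ := by
    intro w
    rw [Complex.cos, norm_div, Complex.norm_ofNat]
    have h1 : ‖Complex.exp (w * Complex.I)‖ ≤ Real.exp ‖w‖ :=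
      (Complex.norm_exp_le_exp_norm _).trans (by simp)
    have h2 : ‖Complex.exp (-w * Complex.I)‖ ≤ Real.exp ‖w‖ :=
      (Complex.norm_exp_le_exp_norm _).trans (by simp)
    have := norm_add_le (Complex.exp (w * Complex.I)) (Complex.exp (-w * Complex.I))
    linarith
  have hpin : ∀ w : ℂ, ‖(Real.pi : ℂ) * w‖ = Real.pi * ‖w‖ := by
    intro w; rw [norm_mul, Complex.norm_real, Real.norm_eq_abs, abs_of_pos Real.pi_pos]
  have haz : ‖a z‖ ≤ Real.exp (Real.pi * 291) := by
    rw [hge z (hsub2 hz)]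
    refine (hcos _).trans (Real.exp_le_exp.2 ?_)
    rw [hpin]; have := Real.pi_pos; gcongr
  have hF : ‖2 * f z - 1‖ ≤ Real.exp (Real.pi * Real.exp (Real.pi * 291)) := by
    have := hae z (hsub2 hz)
    rw [this]
    refine (hcos _).trans (Real.exp_le_exp.2 ?_)
    rw [hpin]; have := Real.pi_pos; gcongr
  have e : f z = ((2 * f z - 1) + 1) / 2 := by ring
  rw [e, norm_div, Complex.norm_ofNat]
  have := norm_add_le (2 * f z - 1) 1
  rw [norm_one] at this
  have := Real.exp_pos (Real.pi * Real.exp (Real.pi * 291))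
  linarith

theorem card_roots_C (P : ℂ[X]) : Multiset.card P.roots = P.natDegree :=
  (IsAlgClosed.splits P).natDegree_eq_card_roots.symm

theorem natDegree_pencil_le (P Q : ℂ[X]) (b : ℂ) :
    (P - C b * Q).natDegree ≤ max P.natDegree Q.natDegree := by
  refine (natDegree_sub_le _ _).trans (max_le_max le_rfl (natDegree_C_mul_le _ _))

theorem fiber_infty (P Q : ℂ[X]) : fiber P Q (OnePoint.infty : Sphere) =
    Multiset.map (fun z : ℂ => (z : Sphere)) Q.roots +
      Multiset.replicate (max P.natDegree Q.natDegree - Q.natDegree) (OnePoint.infty : Sphere) := by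
  simp only [fiber, OnePoint.elim_infty, Multiset.bind_def, Multiset.pure_def, Multiset.bind_singleton,
    Multiset.map_map, Multiset.map_id']
  rfl

theorem fiber_coe (P Q : ℂ[X]) (b : ℂ) : fiber P Q (b : Sphere) =
    Multiset.map (fun z : ℂ => (z : Sphere)) (P - C b * Q).roots +
      Multiset.replicate (max P.natDegree Q.natDegree - (P - C b * Q).natDegree)
        (OnePoint.infty : Sphere) := by
  simp only [fiber, OnePoint.elim_some, Multiset.bind_def, Multiset.pure_def, Multiset.bind_singleton,
    Multiset.map_map, Multiset.map_id']
  rfl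

theorem card_fiber (P Q : ℂ[X]) (a : Sphere) :
    Multiset.card (fiber P Q a) = max P.natDegree Q.natDegree := by
  induction a using OnePoint.rec with
  | infty =>
    simp only [fiber_infty, Multiset.card_add, Multiset.card_map, card_roots_C,
      Multiset.card_replicate]
    have := le_max_right P.natDegree Q.natDegree
    omega
  | coe b =>
    simp only [fiber_coe, Multiset.card_add, Multiset.card_map, card_roots_C,
      Multiset.card_replicate]
    have := natDegree_pencil_le P Q b
    omega

theorem ratEval_coe (P Q : ℂ[X]) (a : ℂ) : ratEval P Q (a : Sphere) =
    if Q.eval a = 0 then (OnePoint.infty : Sphere) else ((P.eval a / Q.eval a : ℂ) : Sphere) := rfl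

theorem not_both_zero {P Q : ℂ[X]} (h : IsCoprime P Q) (a : ℂ) : ¬ (P.eval a = 0 ∧ Q.eval a = 0) := by
  rintro ⟨h1, h2⟩
  obtain ⟨u, v, huv⟩ := h
  have := congrArg (eval a) huv
  simp [h1, h2] at this

theorem coprime_ne_zero {P Q : ℂ[X]} (h : IsCoprime P Q) (hd : 1 ≤ max P.natDegree Q.natDegree) :
    P ≠ 0 ∧ Q ≠ 0 := by
  constructor
  · rintro rfl
    have := isCoprime_zero_left.1 h
    have := natDegree_eq_zero_of_isUnit this
    simp [this] at hd
  · rintro rfl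
    have := isCoprime_zero_right.1 h
    have := natDegree_eq_zero_of_isUnit this
    simp [this] at hd

theorem coeff_top_not_both {P Q : ℂ[X]} (h : IsCoprime P Q) (hd : 1 ≤ max P.natDegree Q.natDegree) :
    ¬ (P.coeff (max P.natDegree Q.natDegree) = 0 ∧ Q.coeff (max P.natDegree Q.natDegree) = 0) := by
  obtain ⟨h1, h2⟩ := coprime_ne_zero h hd
  rcases max_choice P.natDegree Q.natDegree with e | e
  · rw [e]; intro hh; exact h1 (leadingCoeff_eq_zero.1 hh.1)
  · rw [e]; intro hh; exact h2 (leadingCoeff_eq_zero.1 hh.2)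

theorem ratEval_infty {P Q : ℂ[X]} (h : IsCoprime P Q) (hd : 1 ≤ max P.natDegree Q.natDegree) :
    ratEval P Q (OnePoint.infty : Sphere) =
    if Q.coeff (max P.natDegree Q.natDegree) = 0 then (OnePoint.infty : Sphere) else
      ((P.coeff (max P.natDegree Q.natDegree) / Q.coeff (max P.natDegree Q.natDegree) : ℂ) : Sphere) := by
  obtain ⟨h1, h2⟩ := coprime_ne_zero h hd
  simp only [ratEval, OnePoint.elim_infty]
  rcases lt_trichotomy Q.natDegree P.natDegree with e | e | e
  · rw [if_pos e, max_eq_left e.le, coeff_eq_zero_of_natDegree_lt e, if_pos rfl]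
  · rw [if_neg e.not_lt, if_neg e.not_gt, ← e, max_self, coeff_natDegree, if_neg (leadingCoeff_ne_zero.2 h2)]
    rw [leadingCoeff, leadingCoeff, e]
  · rw [if_neg e.not_gt, if_pos e, max_eq_right e.le, coeff_natDegree,
      if_neg (leadingCoeff_ne_zero.2 h2), coeff_eq_zero_of_natDegree_lt e, zero_div]

theorem natDegree_lt_iff_coeff {P : ℂ[X]} {d : ℕ} (hd : 1 ≤ d) (h : P.natDegree ≤ d) :
    0 < d - P.natDegree ↔ P.coeff d = 0 := by
  constructor
  · intro h'; exact coeff_eq_zero_of_natDegree_lt (by omega)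
  · intro h'
    by_contra hc
    have e : d = P.natDegree := by omega
    rw [e, coeff_natDegree, leadingCoeff_eq_zero] at h'
    rw [h', natDegree_zero] at e
    omega

theorem pencil_ne_zero {P Q : ℂ[X]} (h : IsCoprime P Q) (hd : 1 ≤ max P.natDegree Q.natDegree)
    (b : ℂ) : P - C b * Q ≠ 0 := by
  intro h0
  have e : P = C b * Q := sub_eq_zero.1 h0
  have hu : IsUnit Q := by
    apply h.isUnit_of_dvd' (x := Q) ⟨C b, by rw [e]; ring⟩ dvd_rfl
  have hq := natDegree_eq_zero_of_isUnit hu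
  have hp : P.natDegree ≤ Q.natDegree := by rw [e]; exact natDegree_C_mul_le _ _
  rw [max_eq_right hp] at hd; omega

theorem mem_fiber {P Q : ℂ[X]} (h : IsCoprime P Q) (hd : 1 ≤ max P.natDegree Q.natDegree)
    (a z : Sphere) : z ∈ fiber P Q a ↔ ratEval P Q z = a := by
  obtain ⟨h1, h2⟩ := coprime_ne_zero h hd
  have hb0 := coeff_top_not_both h hd
  induction a using OnePoint.rec with
  | infty =>
    simp only [fiber_infty, Multiset.mem_add, Multiset.mem_map,
      Multiset.mem_replicate]
    induction z using OnePoint.rec with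
    | infty =>
      rw [ratEval_infty h hd]
      have := natDegree_lt_iff_coeff hd (le_max_right P.natDegree Q.natDegree)
      by_cases hc : Q.coeff (max P.natDegree Q.natDegree) = 0
      · rw [if_pos hc]; simp only [iff_true]; right; exact ⟨(this.2 hc).ne', trivial⟩
      · rw [if_neg hc]; simp only [OnePoint.coe_ne_infty, and_false, exists_false, false_or, iff_false, and_true, not_not]
        by_contra hh; exact hc (this.1 (Nat.pos_of_ne_zero hh))
    | coe x =>
      rw [ratEval_coe]
      simp [h2]
  | coe b =>
    simp only [fiber_coe, Multiset.mem_add, Multiset.mem_map,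
      Multiset.mem_replicate]
    have hne := pencil_ne_zero h hd b
    induction z using OnePoint.rec with
    | infty =>
      rw [ratEval_infty h hd]
      have := natDegree_lt_iff_coeff hd (natDegree_pencil_le P Q b)
      simp only [OnePoint.coe_ne_infty, and_false, exists_false, false_or, and_true]
      rw [← Nat.pos_iff_ne_zero, this, coeff_sub, coeff_C_mul, sub_eq_zero]
      by_cases hc : Q.coeff (max P.natDegree Q.natDegree) = 0
      · rw [if_pos hc, hc, mul_zero]
        simp only [OnePoint.infty_ne_coe, iff_false]
        exact fun hh => hb0 ⟨hh, hc⟩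
      · rw [if_neg hc, OnePoint.coe_eq_coe, div_eq_iff hc]
    | coe x =>
      rw [ratEval_coe]
      have hnb := not_both_zero h x
      simp only [mem_roots hne, IsRoot.def, OnePoint.coe_eq_coe, exists_eq_right, OnePoint.coe_ne_infty, and_false, or_false,
        eval_sub, eval_mul, eval_C, sub_eq_zero]
      by_cases hc : Q.eval x = 0
      · rw [if_pos hc, hc, mul_zero]
        simp only [OnePoint.infty_ne_coe, iff_false]
        exact fun hh => hnb ⟨hh, hc⟩
      · rw [if_neg hc, OnePoint.coe_eq_coe, div_eq_iff hc]

theorem finite_fib {P Q : ℂ[X]} (h : IsCoprime P Q) (hd : 1 ≤ max P.natDegree Q.natDegree)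
    (a : Sphere) : {z | ratEval P Q z = a}.Finite := by
  refine (fiber P Q a).toFinset.finite_toSet.subset ?_
  intro z hz
  simpa using (mem_fiber h hd a z).2 hz

theorem ratEval_surj {P Q : ℂ[X]} (h : IsCoprime P Q) (hd : 1 ≤ max P.natDegree Q.natDegree) :
    Function.Surjective (ratEval P Q) := by
  intro a
  have := card_fiber P Q a
  obtain ⟨z, hz⟩ := Multiset.card_pos_iff_exists_mem.1 (by omega : 0 < Multiset.card (fiber P Q a))
  exact ⟨z, (mem_fiber h hd a z).1 hz⟩

/-- The set of critical points of a rational map is finite. -/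
theorem finite_crit {P Q : ℂ[X]} (h : IsCoprime P Q) (hd : 1 ≤ max P.natDegree Q.natDegree) :
    {z | 2 ≤ (fiber P Q (ratEval P Q z)).count z}.Finite := by
  have hW : wronskian P Q ≠ 0 := by
    intro h0
    obtain ⟨e1, e2⟩ := h.wronskian_eq_zero_iff.1 h0
    have := natDegree_eq_zero_of_derivative_eq_zero e1
    have := natDegree_eq_zero_of_derivative_eq_zero e2
    omega
  refine (((wronskian P Q).roots.toFinset.finite_toSet.image (fun x : ℂ => (x : Sphere))).union
    (Set.finite_singleton (OnePoint.infty : Sphere))).subset ?_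
  intro z hz
  induction z using OnePoint.rec with
  | infty => right; rfl
  | coe x =>
    left
    refine ⟨x, ?_, rfl⟩
    simp only [Finset.mem_coe, Multiset.mem_toFinset, mem_roots hW, IsRoot.def]
    have hcm : ∀ (M : ℂ[X]) (k : ℕ), Multiset.count (x : Sphere) (Multiset.map (fun z : ℂ => (z : Sphere)) M.roots +
        Multiset.replicate k (OnePoint.infty : Sphere)) = M.rootMultiplicity x := by
      intro M k
      rw [Multiset.count_add, Multiset.count_map_eq_count' _ _ OnePoint.coe_injective,
        Multiset.count_replicate, if_neg (OnePoint.infty_ne_coe x), add_zero, count_roots]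
    simp only [Set.mem_ofPred_eq] at hz
    rw [ratEval_coe] at hz
    have hroot : ∀ M : ℂ[X], 2 ≤ M.rootMultiplicity x → M.eval x = 0 ∧ (derivative M).eval x = 0 := by
      intro M hM
      have h0 : M ≠ 0 := by rintro rfl; simp at hM
      have := (one_lt_rootMultiplicity_iff_isRoot h0 (t := x)).1 (by omega)
      exact this
    by_cases hc : Q.eval x = 0
    · rw [if_pos hc] at hz
      simp only [fiber_infty] at hz
      rw [hcm] at hz
      obtain ⟨e1, e2⟩ := hroot _ hz
      simp [wronskian, e1, e2]
    · rw [if_neg hc] at hz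
      simp only [fiber_coe] at hz
      rw [hcm] at hz
      obtain ⟨e1, e2⟩ := hroot _ hz
      simp only [derivative_sub, derivative_C_mul, eval_sub, eval_mul, eval_C] at e2
      simp only [wronskian, eval_sub, eval_mul]
      have e3 : eval x (derivative P) = eval x P / eval x Q * eval x (derivative Q) := by
        linear_combination e2
      rw [e3]; field_simp; ring

/-- The point `[a : b]`. -/
def frac (a b : ℂ) : Sphere := if b = 0 then (OnePoint.infty : Sphere) else ((a / b : ℂ) : Sphere)

/-- The inversion. -/
def sinv (z : Sphere) : Sphere := OnePoint.elim z ((0 : ℂ) : Sphere) (fun a => frac 1 a)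

theorem sinv_coe (a : ℂ) : sinv (a : Sphere) = frac 1 a := rfl
theorem sinv_infty : sinv (OnePoint.infty : Sphere) = ((0 : ℂ) : Sphere) := rfl

theorem frac_one (a : ℂ) : frac a 1 = (a : Sphere) := by simp [frac]

theorem frac_zero (a : ℂ) : frac a 0 = (OnePoint.infty : Sphere) := by simp [frac]

theorem sinv_frac {a b : ℂ} (h : ¬ (a = 0 ∧ b = 0)) : sinv (frac a b) = frac b a := by
  by_cases hb : b = 0
  · have ha : a ≠ 0 := fun ha => h ⟨ha, hb⟩
    simp [frac, hb, ha, sinv_infty]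
  · by_cases ha : a = 0
    · simp [frac, hb, ha, sinv_coe]
    · simp [frac, hb, ha, sinv_coe]

theorem sinv_sinv (z : Sphere) : sinv (sinv z) = z := by
  induction z using OnePoint.rec with
  | infty => simp [sinv_infty, sinv_coe, frac]
  | coe x => rw [sinv_coe, sinv_frac (by simp), frac_one]

theorem frac_mul {a b t : ℂ} (ht : t ≠ 0) : frac (t * a) (t * b) = frac a b := by
  unfold frac
  by_cases hb : b = 0
  · simp [hb]
  · rw [if_neg (mul_ne_zero ht hb), if_neg hb, mul_div_mul_left _ _ ht]

theorem frac_eq_coe {a b e : ℂ} (h : ¬ (a = 0 ∧ b = 0)) : frac a b = (e : Sphere) ↔ a = e * b := by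
  unfold frac
  by_cases hb : b = 0
  · have ha : a ≠ 0 := fun ha => h ⟨ha, hb⟩
    simp [hb, ha]
  · rw [if_neg hb, OnePoint.coe_eq_coe, div_eq_iff hb]

theorem tendsto_coe_infty : Tendsto (fun z : ℂ => (z : Sphere)) (cocompact ℂ) (𝓝 OnePoint.infty) := by
  have : map (fun z : ℂ => (z : Sphere)) (coclosedCompact ℂ) = 𝓝[≠] OnePoint.infty :=
    OnePoint.nhdsNE_infty_eq.symm
  rw [coclosedCompact_eq_cocompact] at this
  rw [Tendsto, this]
  exact nhdsWithin_le_nhds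

theorem continuous_sinv : Continuous sinv := by
  rw [continuous_iff_continuousAt]
  intro z
  induction z using OnePoint.rec with
  | infty =>
    rw [OnePoint.continuousAt_infty', coclosedCompact_eq_cocompact, sinv_infty]
    have h1 : Tendsto (fun a : ℂ => ((a⁻¹ : ℂ) : Sphere)) (cocompact ℂ) (𝓝 ((0 : ℂ) : Sphere)) := by
      refine (OnePoint.continuous_coe.tendsto 0).comp ?_
      rw [← Metric.cobounded_eq_cocompact]
      exact tendsto_inv₀_cobounded
    refine h1.congr' ?_
    have : ∀ᶠ a : ℂ in cocompact ℂ, a ≠ 0 := by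
      have := (isCompact_singleton (x := (0 : ℂ))).compl_mem_cocompact
      filter_upwards [this] with a ha using ha
    filter_upwards [this] with a ha
    simp [sinv_coe, frac, ha]
  | coe x =>
    rw [OnePoint.continuousAt_coe]
    by_cases hx : x = 0
    · subst hx
      have h1 : ContinuousWithinAt (sinv ∘ (fun z : ℂ => (z : Sphere))) {0}ᶜ 0 := by
        have : Tendsto (fun a : ℂ => ((a⁻¹ : ℂ) : Sphere)) (𝓝[≠] 0) (𝓝 OnePoint.infty) := by
          refine tendsto_coe_infty.comp ?_
          rw [← Metric.cobounded_eq_cocompact]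
          exact tendsto_inv₀_nhdsNE_zero
        have e : (sinv ∘ (fun z : ℂ => (z : Sphere))) 0 = OnePoint.infty := by
          simp [sinv_coe, frac]
        rw [ContinuousWithinAt, e]
        refine this.congr' ?_
        filter_upwards [self_mem_nhdsWithin] with a ha
        have : a ≠ 0 := ha
        simp [sinv_coe, frac, this]
      exact continuousWithinAt_compl_self.1 h1
    · have : ContinuousAt (fun a : ℂ => ((a⁻¹ : ℂ) : Sphere)) x :=
        OnePoint.continuous_coe.continuousAt.comp (continuousAt_inv₀ hx)
      refine this.congr ?_
      filter_upwards [isOpen_ne.mem_nhds hx] with a ha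
      have : a ≠ 0 := ha
      simp [sinv_coe, frac, this]

/-- Inversion as a homeomorphism. -/
def sinvH : Sphere ≃ₜ Sphere where
  toFun := sinv
  invFun := sinv
  left_inv := sinv_sinv
  right_inv := sinv_sinv
  continuous_toFun := continuous_sinv
  continuous_invFun := continuous_sinv

theorem map_sinv_nhds (z : Sphere) : map sinv (𝓝 z) = 𝓝 (sinv z) := sinvH.map_nhds_eq z

theorem map_coe_nhds (z : ℂ) : map (fun z : ℂ => (z : Sphere)) (𝓝 z) = 𝓝 (z : Sphere) :=
  OnePoint.isOpenEmbedding_coe.map_nhds_eq z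

/-- `F : ℂ → Sphere` is globally `[u : v]` with `u`, `v` entire. -/
def SH (F : ℂ → Sphere) : Prop := ∃ u v : ℂ → ℂ, Differentiable ℂ u ∧ Differentiable ℂ v ∧
  (∀ z, ¬ (u z = 0 ∧ v z = 0)) ∧ ∀ z, F z = frac (u z) (v z)

theorem SH_coe : SH (fun z : ℂ => (z : Sphere)) :=
  ⟨fun z => z, fun _ => 1, differentiable_id, differentiable_const _, by simp, fun z => (frac_one z).symm⟩

theorem SH.sinv {F : ℂ → Sphere} (h : SH F) : SH (fun z => sinv (F z)) := by
  obtain ⟨u, v, hu, hv, h0, hF⟩ := h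
  exact ⟨v, u, hv, hu, fun z hz => h0 z hz.symm, fun z => by simp only [hF]; rw [sinv_frac (h0 z)]⟩

theorem SH.continuous {F : ℂ → Sphere} (h : SH F) : Continuous F := by
  have key : ∀ G : ℂ → Sphere, ∀ u v : ℂ → ℂ, Differentiable ℂ u → Differentiable ℂ v →
      (∀ z, G z = frac (u z) (v z)) → ∀ z, v z ≠ 0 → ContinuousAt G z := by
    intro G u v hu hv hG z hz
    have : ContinuousAt (fun z => ((u z / v z : ℂ) : Sphere)) z :=
      OnePoint.continuous_coe.continuousAt.comp (hu.continuous.continuousAt.div hv.continuous.continuousAt hz)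
    refine this.congr ?_
    filter_upwards [hv.continuous.continuousAt.eventually_ne hz] with a ha
    rw [hG, frac, if_neg ha]
  obtain ⟨u, v, hu, hv, h0, hF⟩ := h
  rw [continuous_iff_continuousAt]
  intro z
  by_cases hz : v z = 0
  · have h1 : u z ≠ 0 := fun h => h0 z ⟨h, hz⟩
    have := key (fun z => SkewRational.sinv (F z)) v u hv hu (fun z => by rw [hF, sinv_frac (h0 z)]) z h1
    have := continuous_sinv.continuousAt.comp this
    simpa [Function.comp_def, sinv_sinv] using this
  · exact key F u v hu hv hF z hz

theorem SH.nhds_le {F : ℂ → Sphere} (h : SH F) (z : ℂ) (hnc : ¬ ∀ᶠ x in 𝓝 z, F x = F z) :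
    𝓝 (F z) ≤ map F (𝓝 z) := by
  have key : ∀ G : ℂ → Sphere, ∀ u v : ℂ → ℂ, Differentiable ℂ u → Differentiable ℂ v →
      (∀ z, G z = frac (u z) (v z)) → v z ≠ 0 → (¬ ∀ᶠ x in 𝓝 z, G x = G z) →
      𝓝 (G z) ≤ map G (𝓝 z) := by
    intro G u v hu hv hG hz hn
    have e : G =ᶠ[𝓝 z] fun z => ((u z / v z : ℂ) : Sphere) := by
      filter_upwards [hv.continuous.continuousAt.eventually_ne hz] with a ha
      rw [hG, frac, if_neg ha]
    have ha : AnalyticAt ℂ (fun z => u z / v z) z := (hu.analyticAt z).div (hv.analyticAt z) hz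
    rcases ha.eventually_constant_or_nhds_le_map_nhds with h1 | h1
    · exfalso; apply hn
      filter_upwards [e, h1] with x hx hx1
      rw [hx, hx1, ← e.eq_of_nhds]
    · rw [map_congr e, e.eq_of_nhds, ← map_coe_nhds]
      have h2 := map_mono (m := fun z : ℂ => (z : Sphere)) h1
      rwa [Filter.map_map] at h2
  obtain ⟨u, v, hu, hv, h0, hF⟩ := h
  by_cases hz : v z = 0
  · have h1 : u z ≠ 0 := fun h => h0 z ⟨h, hz⟩
    have := key (fun z => SkewRational.sinv (F z)) v u hv hu (fun z => by rw [hF, sinv_frac (h0 z)]) h1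
      (by
        intro hh; apply hnc
        filter_upwards [hh] with x hx
        have := congrArg SkewRational.sinv hx
        simpa [sinv_sinv] using this)
    have := map_mono (m := SkewRational.sinv) this
    rw [map_sinv_nhds, sinv_sinv, Filter.map_map] at this
    simpa [Function.comp_def, sinv_sinv] using this
  · exact key F u v hu hv hF hz hnc

/-- Homogenization. -/
def hom (d : ℕ) (P : ℂ[X]) (a b : ℂ) : ℂ := ∑ i ∈ Finset.range (d + 1), P.coeff i * a ^ i * b ^ (d - i)

theorem hom_eq {d : ℕ} {P : ℂ[X]} (hd : P.natDegree ≤ d) (a : ℂ) {b : ℂ} (hb : b ≠ 0) :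
    hom d P a b = b ^ d * P.eval (a / b) := by
  rw [eval_eq_sum_range' (Nat.lt_succ_of_le hd), Finset.mul_sum, hom]
  refine Finset.sum_congr rfl fun i hi => ?_
  have hi' : i ≤ d := by simpa [Nat.lt_succ_iff] using hi
  have : b ^ d = b ^ (d - i) * b ^ i := by rw [← pow_add, Nat.sub_add_cancel hi']
  rw [this, div_pow]; field_simp

theorem hom_zero (d : ℕ) (P : ℂ[X]) (a : ℂ) : hom d P a 0 = a ^ d * P.coeff d := by
  rw [hom, Finset.sum_range_succ, Finset.sum_eq_zero]
  · simp; ring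
  · intro i hi
    have : i < d := by simpa using hi
    rw [zero_pow (by omega), mul_zero]

theorem ratEval_frac {P Q : ℂ[X]} (h : IsCoprime P Q) (hd : 1 ≤ max P.natDegree Q.natDegree) {a b : ℂ}
    (hab : ¬ (a = 0 ∧ b = 0)) :
    ratEval P Q (frac a b) = frac (hom (max P.natDegree Q.natDegree) P a b) (hom (max P.natDegree Q.natDegree) Q a b)
    ∧ ¬ (hom (max P.natDegree Q.natDegree) P a b = 0 ∧ hom (max P.natDegree Q.natDegree) Q a b = 0) := by
  by_cases hb : b = 0
  · have ha : a ≠ 0 := fun ha => hab ⟨ha, hb⟩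
    subst hb
    have hp := pow_ne_zero (max P.natDegree Q.natDegree) ha
    rw [hom_zero, hom_zero, frac_zero, ratEval_infty h hd, frac_mul hp]
    refine ⟨rfl, fun hh => coeff_top_not_both h hd ?_⟩
    simpa [hp, ha] using hh
  · have hp := pow_ne_zero (max P.natDegree Q.natDegree) hb
    rw [hom_eq (le_max_left _ _) _ hb, hom_eq (le_max_right _ _) _ hb, frac_mul hp]
    constructor
    · rw [frac, if_neg hb, ratEval_coe]; rfl
    · refine fun hh => not_both_zero h (a / b) ?_
      simpa [hp, hb] using hh

theorem SH.ratEval {F : ℂ → Sphere} (hF : SH F) {P Q : ℂ[X]} (h : IsCoprime P Q)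
    (hd : 1 ≤ max P.natDegree Q.natDegree) : SH (fun z => ratEval P Q (F z)) := by
  obtain ⟨u, v, hu, hv, h0, hF⟩ := hF
  refine ⟨fun z => hom (max P.natDegree Q.natDegree) P (u z) (v z),
    fun z => hom (max P.natDegree Q.natDegree) Q (u z) (v z), ?_, ?_, fun z => (ratEval_frac h hd (h0 z)).2,
    fun z => by simp only [hF]; exact (ratEval_frac h hd (h0 z)).1⟩
  · unfold hom; fun_prop
  · unfold hom; fun_prop

/-- Charts. -/
theorem exists_chart (z : Sphere) : ∃ χ : ℂ → Sphere, ∃ c : ℂ, SH χ ∧ χ c = z ∧ Function.Injective χ ∧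
    map χ (𝓝 c) = 𝓝 z := by
  induction z using OnePoint.rec with
  | infty =>
    refine ⟨fun z => sinv (z : Sphere), 0, SH_coe.sinv, by simp [sinv_coe, frac], ?_, ?_⟩
    · exact sinvH.injective.comp OnePoint.coe_injective
    · have : map sinv (map (fun z : ℂ => (z : Sphere)) (𝓝 0)) = 𝓝 OnePoint.infty := by
        rw [map_coe_nhds, map_sinv_nhds]; simp [sinv_coe, frac]
      rw [Filter.map_map] at this
      exact this
  | coe x => exact ⟨fun z => (z : Sphere), x, SH_coe, rfl, OnePoint.coe_injective, map_coe_nhds x⟩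

theorem continuous_ratEval {P Q : ℂ[X]} (h : IsCoprime P Q)
    (hd : 1 ≤ max P.natDegree Q.natDegree) : Continuous (ratEval P Q) := by
  rw [continuous_iff_continuousAt]
  intro z
  obtain ⟨χ, c, hχ, rfl, hi, hm⟩ := exists_chart z
  rw [ContinuousAt, ← hm, tendsto_map'_iff]
  exact (hχ.ratEval h hd).continuous.continuousAt

theorem isOpenMap_ratEval {P Q : ℂ[X]} (h : IsCoprime P Q)
    (hd : 1 ≤ max P.natDegree Q.natDegree) : IsOpenMap (ratEval P Q) := by
  rw [isOpenMap_iff_nhds_le]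
  intro z
  obtain ⟨χ, c, hχ, rfl, hi, hm⟩ := exists_chart z
  rw [← hm, Filter.map_map]
  refine (hχ.ratEval h hd).nhds_le c ?_
  intro hc
  have hfin : {x | SkewRational.ratEval P Q (χ x) = SkewRational.ratEval P Q (χ c)}.Finite :=
    (finite_fib h hd (SkewRational.ratEval P Q (χ c))).preimage hi.injOn
  exact (infinite_of_mem_nhds c hc) hfin

theorem Good.cop {p q : Fin N → ℂ[X]} (hg : Good p q) (i : Fin N) : IsCoprime (p i) (q i) := hg.2.1 i
theorem Good.deg {p q : Fin N → ℂ[X]} (hg : Good p q) (i : Fin N) :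
    1 ≤ max (p i).natDegree (q i).natDegree := hg.2.2.1 i

theorem SH.itComp {p q : Fin N → ℂ[X]} (hg : Good p q) (w : ℕ → Fin N) {F : ℂ → Sphere} (hF : SH F) (n : ℕ) :
    SH (fun z => itComp p q w n (F z)) := by
  induction n with
  | zero => exact hF
  | succ n ih => exact ih.ratEval (hg.cop (w n)) (hg.deg (w n))

theorem continuous_itComp {p q : Fin N → ℂ[X]} (hg : Good p q) (w : ℕ → Fin N) (n : ℕ) :
    Continuous (itComp p q w n) := by
  induction n with
  | zero => exact continuous_id
  | succ n ih => exact (continuous_ratEval (hg.cop (w n)) (hg.deg (w n))).comp ih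

theorem isOpenMap_itComp {p q : Fin N → ℂ[X]} (hg : Good p q) (w : ℕ → Fin N) (n : ℕ) :
    IsOpenMap (itComp p q w n) := by
  induction n with
  | zero => exact IsOpenMap.id
  | succ n ih => exact (isOpenMap_ratEval (hg.cop (w n)) (hg.deg (w n))).comp ih

theorem sphDist_frac {a b c d : ℂ} (h1 : ¬ (a = 0 ∧ b = 0)) (h2 : ¬ (c = 0 ∧ d = 0)) :
    sphDist (frac a b) (frac c d) =
      2 * ‖a * d - b * c‖ / (Real.sqrt (‖a‖ ^ 2 + ‖b‖ ^ 2) * Real.sqrt (‖c‖ ^ 2 + ‖d‖ ^ 2)) := by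
  have hs : ∀ x y : ℂ, y ≠ 0 → Real.sqrt (1 + ‖x / y‖ ^ 2) = Real.sqrt (‖x‖ ^ 2 + ‖y‖ ^ 2) / ‖y‖ := by
    intro x y hy
    have hy' : 0 < ‖y‖ := norm_pos_iff.2 hy
    rw [eq_div_iff hy'.ne', ← Real.sqrt_sq hy'.le, ← Real.sqrt_mul (by positivity), norm_div,
      Real.sqrt_sq hy'.le]
    congr 1; field_simp; ring
  by_cases hb : b = 0
  · have ha : a ≠ 0 := fun h => h1 ⟨h, hb⟩
    have ha' : 0 < ‖a‖ := norm_pos_iff.2 ha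
    subst hb
    by_cases hd : d = 0
    · subst hd
      simp [frac, sphDist]
    · have hd' : 0 < ‖d‖ := norm_pos_iff.2 hd
      have : 0 < Real.sqrt (‖c‖ ^ 2 + ‖d‖ ^ 2) := by positivity
      simp only [frac, if_true, if_neg hd, sphDist, OnePoint.elim_infty, OnePoint.elim_some]
      rw [hs c d hd]
      simp only [zero_mul, sub_zero, norm_zero, norm_mul]
      rw [zero_pow two_ne_zero, add_zero, Real.sqrt_sq ha'.le]
      field_simp
  · have hb' : 0 < ‖b‖ := norm_pos_iff.2 hb
    have hab : 0 < Real.sqrt (‖a‖ ^ 2 + ‖b‖ ^ 2) := by positivity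
    by_cases hd : d = 0
    · subst hd
      have hc : c ≠ 0 := fun h => h2 ⟨h, rfl⟩
      have hc' : 0 < ‖c‖ := norm_pos_iff.2 hc
      simp only [frac, if_true, if_neg hb, sphDist, OnePoint.elim_infty, OnePoint.elim_some]
      rw [hs a b hb]
      simp only [mul_zero, zero_sub, norm_neg, norm_zero, norm_mul]
      rw [zero_pow two_ne_zero, add_zero, Real.sqrt_sq hc'.le]
      field_simp
    · have hd' : 0 < ‖d‖ := norm_pos_iff.2 hd
      have hcd : 0 < Real.sqrt (‖c‖ ^ 2 + ‖d‖ ^ 2) := by positivity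
      simp only [frac, if_neg hb, if_neg hd, sphDist, OnePoint.elim_some]
      rw [hs a b hb, hs c d hd, dist_eq_norm, div_sub_div _ _ hb hd, norm_div, norm_mul]
      field_simp

theorem sph_mob (A B C D : ℂ) {κ : ℝ} (hκ : 0 < κ) (t s : ℂ)
    (ht : κ ≤ max ‖A * t + B‖ ‖C * t + D‖) (hs : κ ≤ max ‖A * s + B‖ ‖C * s + D‖) :
    sphDist (frac (A * t + B) (C * t + D)) (frac (A * s + B) (C * s + D)) ≤
      2 * ‖A * D - B * C‖ / κ ^ 2 * ‖t - s‖ := by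
  have key : ∀ x y : ℂ, κ ≤ max ‖x‖ ‖y‖ → ¬ (x = 0 ∧ y = 0) ∧ κ ≤ Real.sqrt (‖x‖ ^ 2 + ‖y‖ ^ 2) := by
    intro x y h
    constructor
    · rintro ⟨rfl, rfl⟩; simp at h; linarith
    · apply Real.le_sqrt_of_sq_le
      rcases le_max_iff.1 h with h | h
      · nlinarith [norm_nonneg x, sq_nonneg ‖y‖]
      · nlinarith [norm_nonneg y, sq_nonneg ‖x‖]
  obtain ⟨a1, a2⟩ := key _ _ ht
  obtain ⟨b1, b2⟩ := key _ _ hs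
  rw [sphDist_frac a1 b1]
  have e : (A * t + B) * (C * s + D) - (C * t + D) * (A * s + B) = (A * D - B * C) * (t - s) := by ring
  rw [e, norm_mul, div_mul_eq_mul_div, sq κ, mul_assoc]
  gcongr

/-- Stereographic projection. -/
def ster (z : Sphere) : ℂ × ℝ :=
  OnePoint.elim z (0, 1) (fun a => (((2 / (1 + ‖a‖ ^ 2) : ℝ) : ℂ) * a, 1 - 2 / (1 + ‖a‖ ^ 2)))

theorem ster_coe (a : ℂ) : ster (a : Sphere) =
  (((2 / (1 + ‖a‖ ^ 2) : ℝ) : ℂ) * a, 1 - 2 / (1 + ‖a‖ ^ 2)) := rfl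
theorem ster_infty : ster (OnePoint.infty : Sphere) = (0, 1) := rfl

theorem sphDist_nonneg (z w : Sphere) : 0 ≤ sphDist z w := by
  induction z using OnePoint.rec <;> induction w using OnePoint.rec <;>
    simp only [sphDist, OnePoint.elim_infty, OnePoint.elim_some] <;> positivity

theorem sphDist_sq (z w : Sphere) :
    sphDist z w ^ 2 = ‖(ster z).1 - (ster w).1‖ ^ 2 + ((ster z).2 - (ster w).2) ^ 2 := by
  have inf : ∀ a : ℂ, (2 / Real.sqrt (1 + ‖a‖ ^ 2)) ^ 2 =
      ‖((2 / (1 + ‖a‖ ^ 2) : ℝ) : ℂ) * a‖ ^ 2 + (2 / (1 + ‖a‖ ^ 2)) ^ 2 := by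
    intro a
    have h : 0 < 1 + ‖a‖ ^ 2 := by positivity
    rw [div_pow, Real.sq_sqrt h.le, norm_mul, mul_pow, Complex.norm_real, Real.norm_eq_abs, sq_abs]
    field_simp; ring
  induction z using OnePoint.rec with
  | infty =>
    induction w using OnePoint.rec with
    | infty => simp [sphDist]
    | coe b =>
      rw [ster_coe, ster_infty]
      simp only [sphDist, OnePoint.elim_infty, OnePoint.elim_some]
      rw [inf b, zero_sub, norm_neg]; ring
  | coe a =>
    induction w using OnePoint.rec with
    | infty =>
      rw [ster_coe, ster_infty]
      simp only [sphDist, OnePoint.elim_infty, OnePoint.elim_some]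
      rw [inf a, sub_zero]; ring
    | coe b =>
      rw [ster_coe, ster_coe]
      simp only [sphDist, OnePoint.elim_some]
      have h1 : 0 < 1 + ‖a‖ ^ 2 := by positivity
      have h2 : 0 < 1 + ‖b‖ ^ 2 := by positivity
      rw [div_pow, mul_pow, mul_pow, Real.sq_sqrt h1.le, Real.sq_sqrt h2.le, dist_eq_norm]
      have hs1 : (2 / (1 + ‖a‖ ^ 2)) * (1 + ‖a‖ ^ 2) = 2 := by field_simp
      have hs2 : (2 / (1 + ‖b‖ ^ 2)) * (1 + ‖b‖ ^ 2) = 2 := by field_simp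
      have e : 2 ^ 2 * ‖a - b‖ ^ 2 / ((1 + ‖a‖ ^ 2) * (1 + ‖b‖ ^ 2)) =
        (2 / (1 + ‖a‖ ^ 2)) * (2 / (1 + ‖b‖ ^ 2)) * ‖a - b‖ ^ 2 := by field_simp
      rw [e]
      generalize (2 / (1 + ‖a‖ ^ 2)) = s at *
      generalize (2 / (1 + ‖b‖ ^ 2)) = s' at *
      rw [Complex.sq_norm, Complex.normSq_apply] at *
      rw [Complex.sq_norm, Complex.normSq_apply] at *
      simp only [Complex.sub_re, Complex.sub_im, Complex.re_ofReal_mul, Complex.im_ofReal_mul] at *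
      linear_combination (-s + s') * hs1 + (s - s') * hs2

theorem dist_ster_le (z w : Sphere) : dist (ster z) (ster w) ≤ sphDist z w := by
  have h := sphDist_sq z w
  have h0 := sphDist_nonneg z w
  rw [Prod.dist_eq, dist_eq_norm, Real.dist_eq]
  refine max_le ?_ ?_
  · refine (abs_le_of_sq_le_sq' ?_ h0).2
    nlinarith [sq_nonneg ((ster z).2 - (ster w).2)]
  · refine abs_le_of_sq_le_sq ?_ h0
    nlinarith [sq_nonneg (‖(ster z).1 - (ster w).1‖)]

theorem sphDist_le_ster (z w : Sphere) : sphDist z w ≤ 2 * dist (ster z) (ster w) := by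
  have h := sphDist_sq z w
  have h1 : ‖(ster z).1 - (ster w).1‖ ≤ dist (ster z) (ster w) := by
    rw [Prod.dist_eq, dist_eq_norm]; exact le_max_left _ _
  have h2 : |(ster z).2 - (ster w).2| ≤ dist (ster z) (ster w) := by
    rw [Prod.dist_eq, Real.dist_eq]; exact le_max_right _ _
  refine (abs_le_of_sq_le_sq' ?_ (by positivity)).2
  rw [h, ← sq_abs ((ster z).2 - _)]
  have := dist_nonneg (x := ster z) (y := ster w)
  nlinarith [norm_nonneg ((ster z).1 - (ster w).1), abs_nonneg ((ster z).2 - (ster w).2)]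

theorem continuous_ster : Continuous ster := by
  rw [continuous_iff_continuousAt]
  intro z
  induction z using OnePoint.rec with
  | infty =>
    rw [OnePoint.continuousAt_infty', coclosedCompact_eq_cocompact, tendsto_iff_dist_tendsto_zero]
    have h1 : Tendsto (fun a : ℂ => 2 / ‖a‖) (cocompact ℂ) (𝓝 0) :=
      tendsto_const_nhds.div_atTop (tendsto_norm_cocompact_atTop)
    refine squeeze_zero' (Eventually.of_forall fun _ => dist_nonneg) ?_ h1
    have : ∀ᶠ a : ℂ in cocompact ℂ, a ≠ 0 := by
      have := (isCompact_singleton (x := (0 : ℂ))).compl_mem_cocompact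
      filter_upwards [this] with a ha using ha
    filter_upwards [this] with a ha
    refine (dist_ster_le _ _).trans ?_
    have ha' : 0 < ‖a‖ := norm_pos_iff.2 ha
    simp only [sphDist, OnePoint.elim_infty, OnePoint.elim_some]
    gcongr
    apply Real.le_sqrt_of_sq_le; linarith
  | coe x =>
    rw [OnePoint.continuousAt_coe]
    have : Continuous (ster ∘ (fun z : ℂ => (z : Sphere))) := by
      have e : (ster ∘ (fun z : ℂ => (z : Sphere))) = fun a : ℂ =>
        (((2 / (1 + ‖a‖ ^ 2) : ℝ) : ℂ) * a, 1 - 2 / (1 + ‖a‖ ^ 2)) := rfl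
      rw [e]
      have : Continuous (fun a : ℂ => (2 / (1 + ‖a‖ ^ 2) : ℝ)) := by
        refine continuous_const.div (by fun_prop) (fun a => by positivity)
      fun_prop
    exact this.continuousAt

theorem sphDist_self (z : Sphere) : sphDist z z = 0 := by
  have := sphDist_le_ster z z
  rw [dist_self, mul_zero] at this
  exact le_antisymm this (sphDist_nonneg _ _)

theorem tendsto_sphDist {ι : Type*} {l : Filter ι} {f : ι → Sphere} {z : Sphere} (h : Tendsto f l (𝓝 z)) :
    Tendsto (fun i => sphDist (f i) z) l (𝓝 0) := by
  have h1 : Tendsto (fun i => 2 * dist (ster (f i)) (ster z)) l (𝓝 (2 * 0)) :=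
    (tendsto_iff_dist_tendsto_zero.1 ((continuous_ster.tendsto z).comp h)).const_mul 2
  rw [mul_zero] at h1
  exact squeeze_zero (fun _ => sphDist_nonneg _ _) (fun _ => sphDist_le_ster _ _) h1

theorem montel_lip (ρ δ : ℝ) (hρ : 0 < ρ) (hδ : 0 < δ) : ∃ K : ℝ, 0 < K ∧
    ∀ (c : ℂ) (r : ℝ) (u v : ℂ → ℂ) (a b e : ℂ), 0 < r → Differentiable ℂ u → Differentiable ℂ v →
      ‖a‖ ≤ ρ → ‖b‖ ≤ ρ → ‖e‖ ≤ ρ → δ ≤ ‖b - a‖ → δ ≤ ‖e - a‖ → δ ≤ ‖e - b‖ →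
      (∀ z ∈ Metric.ball c r, u z ≠ a * v z) → (∀ z ∈ Metric.ball c r, u z ≠ b * v z) →
      (∀ z ∈ Metric.ball c r, u z ≠ e * v z) →
      ∀ z ∈ Metric.ball c (r / 2), sphDist (frac (u z) (v z)) (frac (u c) (v c)) ≤ K * ‖z - c‖ / r := by
  obtain ⟨S, hS, hsch⟩ := schottky
  set L : ℝ := 1 + (1 / δ) * (1 + ρ) with hL
  have hL0 : 0 < L := by positivity
  set κ : ℝ := min (1 / (1 + ρ)) (δ / (2 * ρ) ^ 2 / L) with hκ
  have hκ0 : 0 < κ := by positivity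
  refine ⟨2 * (2 / δ) / κ ^ 2 * (4 * (S + 1)), by positivity, ?_⟩
  intro c r u v a b e hr hu hv ha hb he hba hea heb h1 h2 h3
  have hba0 : b - a ≠ 0 := norm_pos_iff.1 (by linarith)
  have hea0 : e - a ≠ 0 := norm_pos_iff.1 (by linarith)
  have heb0 : e - b ≠ 0 := norm_pos_iff.1 (by linarith)
  set β : ℂ := 1 / (b - a) with hβ
  set γ : ℂ := 1 / (e - a) with hγ
  set η : ℂ := γ - β with hη
  have hηe : η = (b - e) / ((b - a) * (e - a)) := by
    rw [hη, hγ, hβ]; field_simp; ring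
  have hη0 : η ≠ 0 := by
    rw [hηe]
    exact div_ne_zero (by rw [← neg_sub]; exact neg_ne_zero.2 heb0) (mul_ne_zero hba0 hea0)
  have hβn : ‖β‖ ≤ 1 / δ := by
    rw [hβ, norm_div, norm_one]; gcongr
  have hγn : ‖γ‖ ≤ 1 / δ := by
    rw [hγ, norm_div, norm_one]; gcongr
  have hηn : ‖η‖ ≤ 2 / δ := by
    have := norm_sub_le γ β
    have e2 : 2 / δ = 1 / δ + 1 / δ := by ring
    rw [e2]; linarith
  have hηl : δ / (2 * ρ) ^ 2 ≤ ‖η‖ := by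
    rw [hηe, norm_div, norm_mul, norm_sub_rev b e, pow_two]
    have k1 : ‖b - a‖ ≤ 2 * ρ := (norm_sub_le _ _).trans (by linarith)
    have k2 : ‖e - a‖ ≤ 2 * ρ := (norm_sub_le _ _).trans (by linarith)
    have : 0 < ‖b - a‖ := by linarith
    have : 0 < ‖e - a‖ := by linarith
    gcongr
  -- the lower bounds
  have low1 : ∀ t : ℂ, κ ≤ max ‖(a * η) * t + (1 + a * β)‖ ‖η * t + β‖ := by
    intro t
    refine (min_le_left _ _).trans ?_
    rw [div_le_iff₀ (by positivity)]
    set x := (a * η) * t + (1 + a * β)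
    set y := η * t + β
    have e1 : (1 : ℂ) = x - a * y := by simp only [x, y]; ring
    have e2 : (1 : ℝ) ≤ ‖x‖ + ρ * ‖y‖ := by
      calc (1 : ℝ) = ‖x - a * y‖ := by rw [← e1, norm_one]
        _ ≤ ‖x‖ + ‖a * y‖ := norm_sub_le _ _
        _ ≤ ‖x‖ + ρ * ‖y‖ := by rw [norm_mul]; gcongr
    have m1 := le_max_left ‖x‖ ‖y‖
    have m2 := le_max_right ‖x‖ ‖y‖
    nlinarith
  have low2 : ∀ t : ℂ, κ ≤ max ‖(1 + a * β) * t + a * η‖ ‖β * t + η‖ := by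
    intro t
    refine (min_le_right _ _).trans ?_
    rw [div_le_iff₀ hL0]
    refine hηl.trans ?_
    set x := (1 + a * β) * t + a * η
    set y := β * t + η
    have e1 : η = y - β * (x - a * y) := by simp only [x, y]; ring
    have m1 := le_max_left ‖x‖ ‖y‖
    have m2 := le_max_right ‖x‖ ‖y‖
    have m0 : 0 ≤ max ‖x‖ ‖y‖ := (norm_nonneg x).trans m1
    calc ‖η‖ = ‖y - β * (x - a * y)‖ := by rw [← e1]
      _ ≤ ‖y‖ + ‖β‖ * ‖x - a * y‖ := by rw [← norm_mul]; exact norm_sub_le _ _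
      _ ≤ ‖y‖ + ‖β‖ * (‖x‖ + ‖a‖ * ‖y‖) := by
        gcongr; rw [← norm_mul]; exact norm_sub_le _ _
      _ ≤ max ‖x‖ ‖y‖ + 1 / δ * (max ‖x‖ ‖y‖ + ρ * max ‖x‖ ‖y‖) := by gcongr
      _ = max ‖x‖ ‖y‖ * L := by rw [hL]; ring
  -- the function
  set g : ℂ → ℂ := fun z => v z / (u z - a * v z) with hgdef
  set f : ℂ → ℂ := fun z => (g z - β) / η with hf
  have hne : ∀ z ∈ Metric.ball c r, u z - a * v z ≠ 0 := fun z hz => sub_ne_zero.2 (h1 z hz)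
  have hfd : DifferentiableOn ℂ f (Metric.ball c r) := by
    refine DifferentiableOn.div_const (DifferentiableOn.sub_const (DifferentiableOn.div hv.differentiableOn
      (hu.sub (hv.const_mul a)).differentiableOn hne) β) η
  have hgf : ∀ z, g z = η * f z + β := by
    intro z; simp only [hf]; field_simp; ring
  have hf0 : ∀ z ∈ Metric.ball c r, f z ≠ 0 := by
    intro z hz hz0
    have h4 := hgf z
    rw [hz0, mul_zero, zero_add, hβ] at h4
    simp only [hgdef] at h4
    rw [div_eq_div_iff (hne z hz) hba0] at h4
    apply h2 z hz; linear_combination -h4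
  have hf1 : ∀ z ∈ Metric.ball c r, f z ≠ 1 := by
    intro z hz hz0
    have h4 := hgf z
    rw [hz0, mul_one, hη, sub_add_cancel, hγ] at h4
    simp only [hgdef] at h4
    rw [div_eq_div_iff (hne z hz) hea0] at h4
    apply h3 z hz; linear_combination -h4
  have hF1 : ∀ z ∈ Metric.ball c r, frac (u z) (v z) =
      frac ((a * η) * f z + (1 + a * β)) (η * f z + β) := by
    intro z hz
    have k := hne z hz
    have e1 : η * f z + β = (u z - a * v z)⁻¹ * v z := by
      rw [← hgf]; simp only [hgdef]; field_simp
    have e2 : (a * η) * f z + (1 + a * β) = (u z - a * v z)⁻¹ * u z := by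
      have : (a * η) * f z + (1 + a * β) = 1 + a * (η * f z + β) := by ring
      rw [this, e1]; field_simp; ring
    rw [e1, e2, frac_mul (inv_ne_zero k)]
  have hF2 : ∀ z ∈ Metric.ball c r, frac (u z) (v z) =
      frac ((1 + a * β) * (f z)⁻¹ + a * η) (β * (f z)⁻¹ + η) := by
    intro z hz
    have k := hf0 z hz
    rw [hF1 z hz, ← frac_mul (inv_ne_zero k)]
    congr 1
    · field_simp; ring
    · field_simp; ring
  have hcb : c ∈ Metric.ball c r := Metric.mem_ball_self hr
  have lipgen : ∀ k : ℂ → ℂ, DifferentiableOn ℂ k (Metric.ball c r) →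
      (∀ z ∈ Metric.ball c r, k z ≠ 0) → (∀ z ∈ Metric.ball c r, k z ≠ 1) → ‖k c‖ ≤ 1 →
      ∀ z ∈ Metric.ball c (r / 2), ‖k z - k c‖ ≤ 4 * (S + 1) / r * ‖z - c‖ := by
    intro k hk k0 k1 kc z hz
    have hb := hsch c r k hr hk k0 k1 kc
    have hmaps : Set.MapsTo k (Metric.ball c (r / 2)) (Metric.closedBall (k c) (2 * (S + 1))) := by
      intro y hy
      rw [Metric.mem_closedBall, dist_eq_norm]
      have := norm_sub_le (k y) (k c)
      have := hb y hy
      linarith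
    have hd := Complex.dist_le_div_mul_dist_of_mapsTo_ball (hk.mono (Metric.ball_subset_ball (by linarith))) hmaps hz
    rw [dist_eq_norm, dist_eq_norm] at hd
    refine hd.trans (le_of_eq ?_)
    field_simp; ring
  intro z hz
  have hzb : z ∈ Metric.ball c r := Metric.ball_subset_ball (by linarith) hz
  by_cases hfc : ‖f c‖ ≤ 1
  · rw [hF1 z hzb, hF1 c hcb]
    refine (sph_mob _ _ _ _ hκ0 _ _ (low1 _) (low1 _)).trans ?_
    have e1 : a * η * β - (1 + a * β) * η = -η := by ring
    rw [e1, norm_neg]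
    have := lipgen f hfd hf0 hf1 hfc z hz
    calc 2 * ‖η‖ / κ ^ 2 * ‖f z - f c‖ ≤ 2 * (2 / δ) / κ ^ 2 * (4 * (S + 1) / r * ‖z - c‖) := by gcongr
      _ = _ := by ring
  · rw [hF2 z hzb, hF2 c hcb]
    refine (sph_mob _ _ _ _ hκ0 _ _ (low2 _) (low2 _)).trans ?_
    have e1 : (1 + a * β) * η - a * η * β = η := by ring
    rw [e1]
    have := lipgen (fun z => (f z)⁻¹) (hfd.inv hf0) (fun z hz => inv_ne_zero (hf0 z hz))
      (fun z hz => by simpa using hf1 z hz)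
      (by rw [norm_inv]; exact inv_le_one_of_one_le₀ (by linarith)) z hz
    calc 2 * ‖η‖ / κ ^ 2 * ‖(f z)⁻¹ - (f c)⁻¹‖ ≤ 2 * (2 / δ) / κ ^ 2 * (4 * (S + 1) / r * ‖z - c‖) := by gcongr
      _ = _ := by ring

theorem normal_of_equi (F : ℕ → Sphere → Sphere) (hF : ∀ n, Continuous (F n)) (B : Set Sphere)
    (hB : IsOpen B) (heq : ∀ y ∈ B, ∀ ε > 0, ∀ᶠ y' in 𝓝 y, ∀ n, sphDist (F n y') (F n y) < ε)
    (z : Sphere) (hz : z ∈ B) :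
    ∃ U : Set Sphere, IsOpen U ∧ z ∈ U ∧ NormalOn {g | ∃ n, 1 ≤ n ∧ g = F n} U := by
  obtain ⟨K, hK, hzK, hKB⟩ := exists_compact_subset hB hz
  have : CompactSpace K := isCompact_iff_compactSpace.1 hK
  refine ⟨interior K, isOpen_interior, hzK, ?_⟩
  let A : ℕ → BoundedContinuousFunction K (ℂ × ℝ) := fun n =>
    BoundedContinuousFunction.mkOfCompact ⟨fun x => ster (F n x),
      continuous_ster.comp ((hF n).comp continuous_subtype_val)⟩
  have hA : ∀ n x, A n x = ster (F n x) := fun n x => rfl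
  have hcr : IsCompact (Set.range ster) := isCompact_range continuous_ster
  have hcomp : IsCompact (closure (Set.range A)) := by
    refine BoundedContinuousFunction.arzela_ascoli (Set.range ster) hcr _ ?_ ?_
    · rintro f x ⟨n, rfl⟩; exact ⟨_, (hA n x).symm⟩
    · intro x
      rw [Metric.equicontinuousAt_iff_right]
      intro ε hε
      have h1 := heq x (hKB x.2) ε hε
      have h2 := (continuous_subtype_val (p := fun y => y ∈ K)).tendsto x
      filter_upwards [h2.eventually h1] with x' hx'
      rintro ⟨f, n, rfl⟩
      change dist (A n x) (A n x') < ε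
      rw [hA, hA, dist_comm]
      exact (dist_ster_le _ _).trans_lt (hx' n)
  intro s hs
  choose k hk1 hk using hs
  obtain ⟨G, hG, φ, hφ, hlim⟩ := hcomp.tendsto_subseq (x := fun n => A (k n)) (fun n => subset_closure ⟨k n, rfl⟩)
  have hpt : ∀ x : K, ∃ y : Sphere, ster y = G x := by
    intro x
    have h1 : Tendsto (fun n => A (k (φ n)) x) atTop (𝓝 (G x)) :=
      ((continuous_eval_const x).tendsto G).comp hlim
    exact hcr.isClosed.mem_of_tendsto h1 (Eventually.of_forall fun n => ⟨_, (hA _ x).symm⟩)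
  choose g hgx using hpt
  refine ⟨φ, hφ, fun y => if hy : y ∈ K then g ⟨y, hy⟩ else y, ?_⟩
  intro K' hK' _ ε hε
  have h3 := Metric.tendsto_nhds.1 hlim (ε / 2) (by positivity)
  filter_upwards [h3] with n hn y hy
  have hyK : y ∈ K := interior_subset (hK' hy)
  simp only [dif_pos hyK]
  refine (sphDist_le_ster _ _).trans_lt ?_
  rw [hgx, hk (φ n)]
  have h4 : dist (A (k (φ n)) ⟨y, hyK⟩) (G ⟨y, hyK⟩) ≤ dist (A (k (φ n))) G :=
    BoundedContinuousFunction.dist_coe_le_dist _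
  rw [hA] at h4
  have h5 : dist (A (k (φ n))) G < ε / 2 := hn
  simp only at h4
  linarith

/-- A set containing three finite points which are `δ`-separated and `ρ`-bounded. -/
def Tri (ρ δ : ℝ) (A : Set Sphere) : Prop := ∃ a b e : ℂ, ‖a‖ ≤ ρ ∧ ‖b‖ ≤ ρ ∧ ‖e‖ ≤ ρ ∧
  δ ≤ ‖b - a‖ ∧ δ ≤ ‖e - a‖ ∧ δ ≤ ‖e - b‖ ∧ (a : Sphere) ∈ A ∧ (b : Sphere) ∈ A ∧ (e : Sphere) ∈ A

theorem fatou_of_omit {p q : Fin N → ℂ[X]} (hg : Good p q) (w : ℕ → Fin N) (B : Set Sphere) (hB : IsOpen B)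
    (z : Sphere) (hz : z ∈ B) (n0 : ℕ) (ρ δ : ℝ) (hρ : 0 < ρ) (hδ : 0 < δ)
    (hom : ∀ n ≥ n0, Tri ρ δ (itComp p q w n '' B)ᶜ) : z ∈ fatouW p q w := by
  refine normal_of_equi (itComp p q w) (continuous_itComp hg w) B hB ?_ z hz
  intro y hy ε hε
  have h1 : ∀ᶠ y' in 𝓝 y, ∀ n < n0, sphDist (itComp p q w n y') (itComp p q w n y) < ε := by
    refine (Filter.eventually_all_finite (Set.finite_lt_nat n0)).2 ?_
    intro n _
    have := tendsto_sphDist ((continuous_itComp hg w n).tendsto y)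
    exact this.eventually (gt_mem_nhds hε)
  have h2 : ∀ᶠ y' in 𝓝 y, ∀ n ≥ n0, sphDist (itComp p q w n y') (itComp p q w n y) < ε := by
    obtain ⟨χ, c, hχ, rfl, hi, hm⟩ := exists_chart y
    obtain ⟨K, hK, hlip⟩ := montel_lip ρ δ hρ hδ
    have hBc : χ ⁻¹' B ∈ 𝓝 c := hχ.continuous.continuousAt.preimage_mem_nhds (hB.mem_nhds hy)
    obtain ⟨r, hr, hrB⟩ := Metric.mem_nhds_iff.1 hBc
    rw [← hm, eventually_map]
    have h3 : Tendsto (fun x : ℂ => K * ‖x - c‖ / r) (𝓝 c) (𝓝 0) := by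
      have : Continuous (fun x : ℂ => K * ‖x - c‖ / r) := by fun_prop
      simpa using this.tendsto c
    filter_upwards [h3.eventually (gt_mem_nhds hε), Metric.ball_mem_nhds c (half_pos hr)] with x hx hxr n hn
    obtain ⟨u, v, hu, hv, h0, hF⟩ := hχ.itComp hg w n
    obtain ⟨a, b, e, ha, hb, he, k1, k2, k3, ma, mb, me⟩ := hom n hn
    have om : ∀ t : ℂ, (t : Sphere) ∈ (itComp p q w n '' B)ᶜ → ∀ z ∈ Metric.ball c r, u z ≠ t * v z := by
      intro t ht z hz h4
      apply ht
      refine ⟨χ z, hrB hz, ?_⟩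
      refine (hF z).trans ?_
      exact (frac_eq_coe (h0 z)).2 h4
    have := hlip c r u v a b e hr hu hv ha hb he k1 k2 k3 (om a ma) (om b mb) (om e me) x hxr
    rw [← hF, ← hF] at this
    exact this.trans_lt hx
  filter_upwards [h1, h2] with y' a1 a2 n
  rcases lt_or_ge n n0 with h | h
  · exact a1 n h
  · exact a2 n h

theorem shiftW_consW (v : Fin N) (w : ℕ → Fin N) : shiftW (consW v w) = w := by
  funext n; simp [shiftW, consW]

theorem consW_zero (v : Fin N) (w : ℕ → Fin N) : consW v w 0 = v := by simp [consW]

theorem consW_shiftW (w : ℕ → Fin N) : consW (w 0) (shiftW w) = w := by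
  funext n
  cases n with
  | zero => simp [consW]
  | succ n => simp [consW, shiftW]

theorem mem_preimT {p q : Fin N → ℂ[X]} (hg : Good p q) (x y : SymX N) :
    y ∈ preimT p q x ↔ Tmap p q y = x := by
  simp only [preimT, Multiset.mem_sum, Multiset.mem_map, Finset.mem_univ, true_and]
  constructor
  · rintro ⟨v, z, hz, rfl⟩
    rw [mem_fiber (hg.cop v) (hg.deg v)] at hz
    simp only [Tmap, consW_zero, shiftW_consW, hz]
  · rintro rfl
    refine ⟨y.1 0, y.2, ?_, ?_⟩
    · rw [mem_fiber (hg.cop _) (hg.deg _)]; rfl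
    · simp only [Tmap, consW_shiftW]

theorem mem_preimTn {p q : Fin N → ℂ[X]} (hg : Good p q) (n : ℕ) (x y : SymX N) :
    y ∈ preimTn p q n x ↔ (Tmap p q)^[n] y = x := by
  induction n generalizing x with
  | zero => simp [preimTn]
  | succ n ih =>
    simp only [preimTn, Multiset.mem_bind, mem_preimT hg, ih, Function.iterate_succ_apply']
    constructor
    · rintro ⟨y', h1, h2⟩; rw [h2, h1]
    · intro h; exact ⟨_, h, rfl⟩

theorem card_preimT (x : SymX N) : Multiset.card (preimT p q x) = Dtot p q := by
  simp only [preimT, Multiset.card_sum, Multiset.card_map, card_fiber, Dtot, degR]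

theorem card_preimTn (n : ℕ) (x : SymX N) : Multiset.card (preimTn p q n x) = Dtot p q ^ n := by
  induction n generalizing x with
  | zero => simp [preimTn]
  | succ n ih =>
    simp only [preimTn, Multiset.card_bind, Function.comp_def, ih, Multiset.map_const', Multiset.sum_replicate,
      card_preimT, smul_eq_mul]
    ring

theorem itComp_succ' (w : ℕ → Fin N) (n : ℕ) (z : Sphere) :
    itComp p q w (n + 1) z = itComp p q (shiftW w) n (ratEval (p (w 0)) (q (w 0)) z) := by
  induction n with
  | zero => rfl
  | succ n ih =>
    change ratEval _ _ (itComp p q w (n + 1) z) = ratEval _ _ (itComp p q (shiftW w) n _)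
    rw [ih]; rfl

theorem iter_shiftW (w : ℕ → Fin N) (n : ℕ) : shiftW^[n] w = fun k => w (k + n) := by
  induction n with
  | zero => rfl
  | succ n ih =>
    rw [Function.iterate_succ_apply', ih]; funext k; simp only [shiftW]; congr 1; ring

theorem Tmap_iter (n : ℕ) (x : SymX N) :
    (Tmap p q)^[n] x = (shiftW^[n] x.1, itComp p q x.1 n x.2) := by
  induction n with
  | zero => rfl
  | succ n ih =>
    rw [Function.iterate_succ_apply', ih, Function.iterate_succ_apply']
    simp only [Tmap, iter_shiftW, zero_add]
    rfl

theorem itComp_congr {w w' : ℕ → Fin N} {n : ℕ} (h : ∀ k < n, w k = w' k) :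
    itComp p q w n = itComp p q w' n := by
  induction n with
  | zero => rfl
  | succ n ih =>
    simp only [itComp]
    rw [ih (fun k hk => h k (by omega)), h n (by omega)]

/-- First `n` letters of `w` followed by `u`. -/
def catW (w : ℕ → Fin N) (n : ℕ) (u : ℕ → Fin N) : ℕ → Fin N := fun k => if k < n then w k else u (k - n)

theorem Tmap_catW (w u : ℕ → Fin N) (n : ℕ) (z : Sphere) :
    (Tmap p q)^[n] (catW w n u, z) = (u, itComp p q w n z) := by
  rw [Tmap_iter, iter_shiftW]
  refine Prod.ext ?_ ?_
  · funext k; simp [catW]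
  · simp only
    rw [itComp_congr p q (w' := w)]
    intro k hk; simp [catW, hk]

theorem itComp_const (i : Fin N) (n : ℕ) : itComp p q (fun _ => i) n = (ratEval (p i) (q i))^[n] := by
  induction n with
  | zero => rfl
  | succ n ih => rw [itComp, ih, Function.iterate_succ']

theorem cyl_of_nhds {A : Set (ℕ → Fin N)} {w : ℕ → Fin N} (h : A ∈ 𝓝 w) :
    ∃ n0 : ℕ, ∀ w' : ℕ → Fin N, (∀ k < n0, w' k = w k) → w' ∈ A := by
  obtain ⟨O, hO, hOo, hw⟩ := mem_nhds_iff.1 h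
  obtain ⟨I, u, h1, h2⟩ := isOpen_pi_iff.1 hOo w hw
  refine ⟨I.sup id + 1, fun w' hw' => hO (h2 ?_)⟩
  intro k hk
  rw [hw' k (Nat.lt_succ_of_le (Finset.le_sup (f := id) hk))]
  exact (h1 k hk).2

theorem continuous_consW (v : Fin N) : Continuous (consW v : (ℕ → Fin N) → (ℕ → Fin N)) := by
  refine continuous_pi fun n => ?_
  unfold consW
  by_cases h : n = 0
  · simp only [h, if_true]; exact continuous_const
  · simp only [h, if_false]; exact continuous_apply _

theorem isOpenMap_Tmap {p q : Fin N → ℂ[X]} (hg : Good p q) : IsOpenMap (Tmap p q) := by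
  rw [isOpenMap_iff_nhds_le]
  rintro ⟨w, z⟩ S hS
  rw [mem_map] at hS
  obtain ⟨A, hA, B, hB, hAB⟩ := mem_nhds_prod_iff.1 hS
  have h1 : consW (w 0) ⁻¹' A ∈ 𝓝 (shiftW w) := by
    apply (continuous_consW (w 0)).continuousAt.preimage_mem_nhds
    rw [consW_shiftW]; exact hA
  have h2 := (isOpenMap_ratEval (hg.cop (w 0)) (hg.deg (w 0))).image_mem_nhds hB
  refine mem_of_superset (prod_mem_nhds h1 h2) ?_
  rintro ⟨u, y⟩ ⟨hu, b, hb, rfl⟩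
  have h3 : (consW (w 0) u, b) ∈ A ×ˢ B := ⟨hu, hb⟩
  have h4 := hAB h3
  simpa [Tmap, consW_zero, shiftW_consW] using h4

theorem fatou_push {p q : Fin N → ℂ[X]} (hg : Good p q) {w : ℕ → Fin N} {z : Sphere} (hz : z ∈ fatouW p q w) :
    ratEval (p (w 0)) (q (w 0)) z ∈ fatouW p q (shiftW w) := by
  obtain ⟨U, hU, hzU, hn⟩ := hz
  obtain ⟨K, hK, hzK, hKU⟩ := exists_compact_subset hU hzU
  set R := ratEval (p (w 0)) (q (w 0)) with hR
  refine ⟨R '' interior K, (isOpenMap_ratEval (hg.cop (w 0)) (hg.deg (w 0))) _ isOpen_interior,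
    ⟨z, hzK, rfl⟩, ?_⟩
  intro s hs
  choose k hk1 hk using hs
  obtain ⟨φ, hφ, g, hgl⟩ := hn (fun n => itComp p q w (k n + 1)) (fun n => ⟨k n + 1, by omega, rfl⟩)
  refine ⟨φ, hφ, fun y => if hy : ∃ x ∈ interior K, R x = y then g hy.choose else y, ?_⟩
  intro K' hK' _ ε hε
  filter_upwards [hgl K hKU hK ε hε] with n hn y hy
  have hy' : ∃ x ∈ interior K, R x = y := hK' hy
  simp only [dif_pos hy']
  have h1 := hn hy'.choose (interior_subset hy'.choose_spec.1)
  rw [itComp_succ', ← hR, hy'.choose_spec.2] at h1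
  rw [hk]; exact h1

theorem julia_back {p q : Fin N → ℂ[X]} (hg : Good p q) {x : SymX N} (hx : Tmap p q x ∈ juliaSet p q) :
    x ∈ juliaSet p q := by
  have h1 := (isOpenMap_Tmap hg).preimage_closure_subset_closure_preimage (show x ∈ Tmap p q ⁻¹' closure _ from hx)
  refine closure_mono ?_ h1
  rintro ⟨w, z⟩ h
  simp only [Set.mem_preimage, Set.mem_iUnion, Set.mem_prod, Set.mem_singleton_iff, Tmap] at h
  obtain ⟨w', rfl, h2⟩ := h
  simp only [Set.mem_iUnion, Set.mem_prod, Set.mem_singleton_iff]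
  exact ⟨w, rfl, fun h3 => h2 (fatou_push hg h3)⟩

theorem julia_back_iter {p q : Fin N → ℂ[X]} (hg : Good p q) (n : ℕ) {x : SymX N}
    (hx : (Tmap p q)^[n] x ∈ juliaSet p q) : x ∈ juliaSet p q := by
  induction n generalizing x with
  | zero => exact hx
  | succ n ih => exact julia_back hg (ih (by rwa [Function.iterate_succ_apply] at hx))

theorem iter_surj {p q : Fin N → ℂ[X]} (hg : Good p q) (i : Fin N) (k : ℕ) :
    Function.Surjective (ratEval (p i) (q i))^[k] := (ratEval_surj (hg.cop i) (hg.deg i)).iterate k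

theorem snd_back {p q : Fin N → ℂ[X]} (hg : Good p q) (i : Fin N) (k : ℕ) {y b : Sphere}
    (hy : y ∈ Prod.snd '' juliaSet p q) (hb : (ratEval (p i) (q i))^[k] b = y) :
    b ∈ Prod.snd '' juliaSet p q := by
  obtain ⟨⟨u, y'⟩, h1, rfl⟩ := hy
  refine ⟨(catW (fun _ => i) k u, b), julia_back_iter hg k ?_, rfl⟩
  rw [Tmap_catW, itComp_const, hb]; exact h1

theorem finite_iter {p q : Fin N → ℂ[X]} (hg : Good p q) (i : Fin N) (k : ℕ) (y : Sphere) :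
    {z | (ratEval (p i) (q i))^[k] z = y}.Finite := by
  induction k generalizing y with
  | zero => simp
  | succ k ih =>
    have : {z | (ratEval (p i) (q i))^[k + 1] z = y} ⊆
        ⋃ b ∈ {b | ratEval (p i) (q i) b = y}, {z | (ratEval (p i) (q i))^[k] z = b} := by
      intro z hz
      simp only [Set.mem_ofPred_eq, Function.iterate_succ_apply'] at hz
      simp only [Set.mem_iUnion, Set.mem_ofPred_eq]
      exact ⟨_, hz, rfl⟩
    exact ((finite_fib (hg.cop i) (hg.deg i) y).biUnion fun b _ => ih b).subset this

theorem tendsto_catW (w u : ℕ → Fin N) {f : ℕ → ℕ} (hf : Tendsto f atTop atTop) :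
    Tendsto (fun n => catW w (f n) u) atTop (𝓝 w) := by
  rw [tendsto_pi_nhds]
  intro k
  refine tendsto_const_nhds.congr' ?_
  filter_upwards [hf.eventually_gt_atTop k] with n hn
  simp [catW, hn]

theorem exists_four {p q : Fin N → ℂ[X]} (hg : Good p q) (hA1 : NoSuperAttract p q) (i : Fin N)
    (hi : 2 ≤ degR p q i) {y : Sphere} (hy : y ∈ Prod.snd '' juliaSet p q) :
    ∃ k, 4 ≤ {z | (ratEval (p i) (q i))^[k] z = y}.ncard := by
  by_contra hcon
  push Not at hcon
  set R := ratEval (p i) (q i) with hR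
  set A : ℕ → Set Sphere := fun k => {z | R^[k] z = y} with hA
  have hfin : ∀ k, (A k).Finite := fun k => finite_iter hg i k y
  have hsurj : Function.Surjective R := ratEval_surj (hg.cop i) (hg.deg i)
  have himg : ∀ k, R '' A (k + 1) = A k := by
    intro k
    ext z; constructor
    · rintro ⟨x, hx, rfl⟩
      simpa only [hA, Set.mem_ofPred_eq, Function.iterate_succ_apply] using hx
    · intro hz
      obtain ⟨x, rfl⟩ := hsurj z
      refine ⟨x, ?_, rfl⟩
      simpa only [hA, Set.mem_ofPred_eq, Function.iterate_succ_apply] using hz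
  have hmono : Monotone (fun k => (A k).ncard) := by
    refine monotone_nat_of_le_succ fun k => ?_
    rw [← himg k]; exact Set.ncard_image_le (hfin _)
  have hstab : ∃ k0, ∀ k ≥ k0, (A k).ncard = (A k0).ncard := by
    have hb : BddAbove (Set.range fun k => (A k).ncard) := ⟨4, by rintro _ ⟨k, rfl⟩; exact (hcon k).le⟩
    obtain ⟨k0, hk0⟩ := Nat.sSup_mem (Set.range_nonempty fun k => (A k).ncard) hb
    refine ⟨k0, fun k hk => le_antisymm ?_ (hmono hk)⟩
    have hk0' : (A k0).ncard = _ := hk0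
    rw [hk0']; exact le_csSup hb ⟨k, rfl⟩
  obtain ⟨k0, hk0⟩ := hstab
  have hcrit : ∀ k > k0, ∀ e ∈ A k, 2 ≤ (fiber (p i) (q i) (R e)).count e := by
    intro k hk e he
    obtain ⟨j, rfl⟩ : ∃ j, k = j + 1 := ⟨k - 1, by omega⟩
    have hinj : Set.InjOn R (A (j + 1)) := by
      refine Set.injOn_of_ncard_image_eq ?_ (hfin _)
      rw [himg, hk0 j (by omega), hk0 (j + 1) (by omega)]
    have hall : ∀ z ∈ fiber (p i) (q i) (R e), z = e := by
      intro z hz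
      rw [mem_fiber (hg.cop i) (hg.deg i)] at hz
      refine hinj ?_ he hz
      have he' : R^[j] (R e) = y := by
        simpa only [hA, Set.mem_ofPred_eq, Function.iterate_succ_apply] using he
      simp only [hA, Set.mem_ofPred_eq, Function.iterate_succ_apply]
      rw [hR] at he' ⊢
      rw [hz]; exact he'
    rw [Multiset.eq_replicate.2 ⟨card_fiber _ _ _, hall⟩, Multiset.count_replicate_self]
    exact hi
  obtain ⟨ψ, hψ⟩ := hsurj.hasRightInverse
  have hψj : ∀ j t, R^[j] (ψ^[j + t] y) = ψ^[t] y := by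
    intro j t
    rw [Function.iterate_add_apply]
    exact (hψ.iterate j) _
  have hψA : ∀ j, ψ^[j] y ∈ A j := fun j => hψj j 0
  have hfc : {z | 2 ≤ (fiber (p i) (q i) (R z)).count z}.Finite := finite_crit (hg.cop i) (hg.deg i)
  obtain ⟨a, b, hab, heq⟩ : ∃ a b : ℕ, a < b ∧ ψ^[k0 + 1 + a] y = ψ^[k0 + 1 + b] y := by
    have hm : Set.MapsTo (fun n : ℕ => ψ^[k0 + 1 + n] y) Set.univ
        {z | 2 ≤ (fiber (p i) (q i) (R z)).count z} :=
      fun n _ => hcrit _ (by omega) _ (hψA _)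
    obtain ⟨a, _, b, _, hab, he⟩ := Set.infinite_univ.exists_ne_map_eq_of_mapsTo hm hfc
    rcases lt_or_gt_of_ne hab with h | h
    · exact ⟨a, b, h, he⟩
    · exact ⟨b, a, h, he.symm⟩
  set B := k0 + 1 + b with hB
  set t := b - a with ht
  set e := ψ^[B] y with he
  have hper : R^[t] e = e := by
    have h1 : B = t + (k0 + 1 + a) := by omega
    have h2 := hψj t (k0 + 1 + a)
    rw [← h1, heq] at h2
    exact h2
  have hpern : ∀ n, R^[B + n * t] e = y := by
    intro n
    rw [Function.iterate_add_apply, mul_comm, Function.iterate_mul, Function.iterate_fixed hper]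
    exact hψA B
  obtain ⟨⟨u, y'⟩, hJ, hyy⟩ := hy
  simp only at hyy
  subst hyy
  have hmem : ((fun _ => i, e) : SymX N) ∈ juliaSet p q := by
    have hcl : IsClosed (juliaSet p q) := isClosed_closure
    have hf : Tendsto (fun n => B + n * t) atTop atTop :=
      tendsto_atTop_mono (fun n => by nlinarith [show 1 ≤ t by omega] : ∀ n, n ≤ B + n * t) tendsto_id
    have hlim : Tendsto (fun n => ((catW (fun _ => i) (B + n * t) u, e) : SymX N)) atTop (𝓝 (fun _ => i, e)) :=
      (tendsto_catW (fun _ => i) u hf).prodMk_nhds tendsto_const_nhds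
    refine hcl.mem_of_tendsto hlim (Eventually.of_forall fun n => julia_back_iter hg (B + n * t) ?_)
    rw [Tmap_catW, itComp_const, ← hR, hpern]; exact hJ
  refine hA1 _ hmem t (by omega) ?_ 0 (by omega) ?_
  · rw [Tmap_iter, iter_shiftW]
    refine Prod.ext rfl ?_
    simp only
    rw [itComp_const]; exact hper
  · exact hcrit B (by omega) e (hψA B)

theorem isOpen_tuples {X Y ι : Type*} [TopologicalSpace X] [TopologicalSpace Y] [Finite ι]
    {g : X → Y} (hg : IsOpenMap g) {S : Set (ι → X)} (hS : IsOpen S) :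
    IsOpen {y | ∃ f ∈ S, ∀ j, g (f j) = y} := by
  rw [isOpen_iff_mem_nhds]
  rintro y ⟨f, hf, hy⟩
  have h1 : S ∈ 𝓝 f := hS.mem_nhds hf
  rw [nhds_pi, Filter.mem_pi] at h1
  obtain ⟨I, hI, t, ht, hts⟩ := h1
  have h2 : ∀ᶠ y' in 𝓝 y, ∀ j, y' ∈ g '' t j := by
    rw [eventually_all]
    intro j
    rw [← hy j]
    exact hg.image_mem_nhds (ht j)
  filter_upwards [h2] with y' hy'
  choose f' hf' hgf using hy'
  exact ⟨f', hts fun j _ => hf' j, hgf⟩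

theorem isOpen_inj {n : ℕ} {X : Type*} [TopologicalSpace X] [T2Space X] :
    IsOpen {f : Fin n → X | Function.Injective f} := by
  have : {f : Fin n → X | Function.Injective f} = ⋂ i, ⋂ j, {f | i ≠ j → f i ≠ f j} := by
    ext f
    simp only [Set.mem_ofPred_eq, Set.mem_iInter]
    constructor
    · intro h i j hij he; exact hij (h he)
    · intro h i j he; by_contra hij; exact h i j hij he
  rw [this]
  refine isOpen_iInter_of_finite fun i => isOpen_iInter_of_finite fun j => ?_
  by_cases hij : i = j
  · simp [hij]
  · simp only [ne_eq, hij, not_false_eq_true, true_implies]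
    exact isOpen_ne_fun (continuous_apply i) (continuous_apply j)

theorem isCompact_julia : IsCompact (juliaSet p q) := isClosed_closure.isCompact

theorem uniform_tri {p q : Fin N → ℂ[X]} (hg : Good p q) (hA1 : NoSuperAttract p q) (i : Fin N)
    (hi : 2 ≤ degR p q i) :
    ∃ (K : ℕ) (ρ δ : ℝ), 0 < ρ ∧ 0 < δ ∧ ∀ y ∈ Prod.snd '' juliaSet p q, ∀ j ≥ K,
      Tri ρ δ {z | (ratEval (p i) (q i))^[j] z = y} := by
  set R := ratEval (p i) (q i) with hR
  have hRo : IsOpenMap R := isOpenMap_ratEval (hg.cop i) (hg.deg i)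
  have hRs : Function.Surjective R := ratEval_surj (hg.cop i) (hg.deg i)
  have hRko : ∀ k, IsOpenMap (R^[k]) := fun k => by
    have := isOpenMap_itComp hg (fun _ => i) k
    rwa [itComp_const] at this
  have hcomp : IsCompact (Prod.snd '' juliaSet p q) := (isCompact_julia p q).image continuous_snd
  -- step one
  set O : ℕ → Set Sphere := fun k => {y | ∃ f ∈ {f : Fin 4 → Sphere | Function.Injective f}, ∀ j, R^[k] (f j) = y} with hO
  have hOo : ∀ k, IsOpen (O k) := fun k => isOpen_tuples (hRko k) isOpen_inj
  have hOm : Monotone O := by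
    refine monotone_nat_of_le_succ fun k => ?_
    rintro y ⟨f, hf, hy⟩
    obtain ⟨ψ, hψ⟩ := hRs.hasRightInverse
    refine ⟨fun j => ψ (f j), fun a b hab => hf (hψ.injective hab), fun j => ?_⟩
    rw [Function.iterate_succ_apply, hψ]; exact hy j
  have hOc : Prod.snd '' juliaSet p q ⊆ ⋃ k, O k := by
    intro y hy
    obtain ⟨k, hk⟩ := exists_four hg hA1 i hi hy
    refine Set.mem_iUnion.2 ⟨k, ?_⟩
    obtain ⟨t, ht, htc⟩ := Set.exists_subset_card_eq hk
    have htf : t.Finite := Set.finite_of_ncard_ne_zero (by omega)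
    have hcard : Nat.card t = 4 := by rw [Nat.card_coe_set_eq]; exact htc
    have : Finite t := htf
    let eqv := Finite.equivFinOfCardEq hcard
    exact ⟨fun j => (eqv.symm j : Sphere), fun a b hab => eqv.symm.injective (Subtype.ext hab),
      fun j => ht (eqv.symm j).2⟩
  obtain ⟨K, hK⟩ := hcomp.elim_directed_cover O hOo hOc hOm.directed_le
  -- step two
  set S : ℕ → Set (Fin 3 → ℂ) := fun t => {a | ∀ j, ‖a j‖ < t ∧ ∀ l, j ≠ l → 1 / ((t : ℝ) + 1) < ‖a j - a l‖} with hS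
  have hSo : ∀ t, IsOpen (S t) := by
    intro t
    simp only [hS, Set.ofPred_forall, Set.ofPred_and]
    refine isOpen_iInter_of_finite fun j => IsOpen.inter ?_ (isOpen_iInter_of_finite fun l => ?_)
    · exact isOpen_lt (by fun_prop) continuous_const
    · by_cases h : j = l
      · simp [h]
      · simp only [ne_eq, h, not_false_eq_true, Set.iInter_true]
        exact isOpen_lt continuous_const (by fun_prop)
  set O' : ℕ → Set Sphere := fun t => {y | ∃ a ∈ S t, ∀ j, (fun z : ℂ => R^[K] (z : Sphere)) (a j) = y} with hO'
  have hO'o : ∀ t, IsOpen (O' t) := fun t =>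
    isOpen_tuples ((hRko K).comp OnePoint.isOpenEmbedding_coe.isOpenMap) (hSo t)
  have hO'm : Monotone O' := by
    refine monotone_nat_of_le_succ fun t => ?_
    rintro y ⟨a, ha, hy⟩
    refine ⟨a, fun j => ⟨(ha j).1.trans (by push_cast; linarith), fun l hl => ?_⟩, hy⟩
    refine lt_of_le_of_lt ?_ ((ha j).2 l hl)
    gcongr; push_cast; linarith
  have hO'c : Prod.snd '' juliaSet p q ⊆ ⋃ k, O' k := by
    intro y hy
    obtain ⟨f, hf, hfy⟩ := hK hy
    have hf : Function.Injective f := hf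
    obtain ⟨j0, hj0⟩ : ∃ j0 : Fin 4, ∀ j, j ≠ j0 → f j ≠ OnePoint.infty := by
      by_cases h : ∃ j0, f j0 = OnePoint.infty
      · obtain ⟨j0, h⟩ := h
        exact ⟨j0, fun j hj he => hj (hf (he.trans h.symm))⟩
      · push Not at h
        exact ⟨0, fun j _ => h j⟩
    have h1 : ∀ j : Fin 3, ∃ a : ℂ, (a : Sphere) = f (j0.succAbove j) := fun j =>
      OnePoint.ne_infty_iff_exists.1 (hj0 _ (Fin.succAbove_ne j0 j))
    choose a ha using h1
    have hai : Function.Injective a := by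
      intro x y hxy
      apply Fin.succAbove_right_injective (p := j0)
      apply hf
      rw [← ha, ← ha, hxy]
    have h2 : ∀ᶠ t : ℕ in atTop, ∀ j, ‖a j‖ < t ∧ ∀ l, j ≠ l → 1 / ((t : ℝ) + 1) < ‖a j - a l‖ := by
      rw [eventually_all]
      intro j
      refine ((tendsto_natCast_atTop_atTop (R := ℝ)).eventually_gt_atTop _).and ?_
      rw [eventually_all]
      intro l
      by_cases h : j = l
      · simp [h]
      · have : 0 < ‖a j - a l‖ := norm_pos_iff.2 (sub_ne_zero.2 (fun hh => h (hai hh)))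
        filter_upwards [(tendsto_one_div_add_atTop_nhds_zero_nat (𝕜 := ℝ)).eventually (gt_mem_nhds this)] with t ht _
        exact ht
    obtain ⟨t, ht⟩ := h2.exists
    refine Set.mem_iUnion.2 ⟨t, a, ht, fun j => ?_⟩
    simp only
    rw [ha]; exact hfy _
  obtain ⟨t, ht⟩ := hcomp.elim_directed_cover O' hO'o hO'c hO'm.directed_le
  refine ⟨K, t + 1, 1 / ((t : ℝ) + 1), by positivity, by positivity, ?_⟩
  intro y hy j hj
  obtain ⟨y', hy'⟩ := iter_surj hg i (j - K) y
  obtain ⟨a, ha, hay⟩ := ht (snd_back hg i (j - K) hy hy')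
  have hm : ∀ l, (a l : Sphere) ∈ {z | R^[j] z = y} := by
    intro l
    have e : j = (j - K) + K := by omega
    simp only [Set.mem_ofPred_eq]
    rw [e, Function.iterate_add_apply]
    have := hay l
    simp only at this
    rw [this]; exact hy'
  have hb : ∀ l, ‖a l‖ ≤ (t : ℝ) + 1 := fun l => (ha l).1.le.trans (by linarith)
  exact ⟨a 0, a 1, a 2, hb 0, hb 1, hb 2, ((ha 1).2 0 (by decide)).le, ((ha 2).2 0 (by decide)).le,
    ((ha 2).2 1 (by decide)).le, hm 0, hm 1, hm 2⟩

theorem exactness {p q : Fin N → ℂ[X]} (hg : Good p q) (hA1 : NoSuperAttract p q) (U : Set (SymX N))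
    (hU : IsOpen U) (hne : (U ∩ juliaSet p q).Nonempty) :
    ∃ m0, ∀ m ≥ m0, ∀ x ∈ juliaSet p q, ∃ y ∈ U, (Tmap p q)^[m] y = x := by
  by_contra hcon
  push Not at hcon
  obtain ⟨i, hi⟩ := hg.2.2.2
  obtain ⟨K, ρ, δ, hρ, hδ, htri⟩ := uniform_tri hg hA1 i hi
  obtain ⟨x0, hx0U, hx0J⟩ := hne
  obtain ⟨⟨w, z⟩, hwzU, hwz⟩ := mem_closure_iff.1 hx0J U hU hx0U
  simp only [Set.mem_iUnion, Set.mem_prod, Set.mem_singleton_iff] at hwz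
  obtain ⟨w', rfl, hzJ⟩ := hwz
  obtain ⟨A, hA, B0, hB0, hAB⟩ := mem_nhds_prod_iff.1 (hU.mem_nhds hwzU)
  obtain ⟨B, hBB, hB, hzB⟩ := mem_nhds_iff.1 hB0
  obtain ⟨n0, hn0⟩ := cyl_of_nhds hA
  apply hzJ
  refine fatou_of_omit hg w B hB z hzB n0 ρ δ hρ hδ ?_
  intro n hn
  obtain ⟨m, hm, ⟨u, y⟩, hxJ, hx⟩ := hcon (n + K)
  obtain ⟨a, b, e, h1, h2, h3, h4, h5, h6, ma, mb, me⟩ := htri y ⟨_, hxJ, rfl⟩ (m - n) (by omega)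
  have key : ∀ c ∈ {z | (ratEval (p i) (q i))^[m - n] z = y}, c ∈ (itComp p q w n '' B)ᶜ := by
    rintro c hc ⟨b, hb, rfl⟩
    refine hx (catW w n (catW (fun _ => i) (m - n) u), b) (hAB ⟨hn0 _ fun k hk => ?_, hBB hb⟩) ?_
    · simp [catW, show k < n by omega]
    · have e : m = (m - n) + n := by omega
      rw [e, Function.iterate_add_apply, ← e, Tmap_catW, Tmap_catW, itComp_const]
      exact Prod.ext rfl hc
  exact ⟨a, b, e, h1, h2, h3, h4, h5, h6, key _ ma, key _ mb, key _ me⟩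

theorem sum_le_card_sub {α : Type*} (s : Multiset α) (f : α → ℝ) (M δ : ℝ) (h : ∀ y ∈ s, f y ≤ M)
    {y : α} (hy : y ∈ s) (hyf : f y ≤ M - δ) : (s.map f).sum ≤ Multiset.card s * M - δ := by
  obtain ⟨t, rfl⟩ := Multiset.exists_cons_of_mem hy
  rw [Multiset.map_cons, Multiset.sum_cons, Multiset.card_cons]
  have h1 : (t.map f).sum ≤ Multiset.card (t.map f) • M := by
    refine Multiset.sum_le_card_nsmul _ _ ?_
    intro x hx
    obtain ⟨z, hz, rfl⟩ := Multiset.mem_map.1 hx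
    exact h z (Multiset.mem_cons_of_mem hz)
  rw [Multiset.card_map, nsmul_eq_mul] at h1
  push_cast
  linarith

theorem Dtot_pos {p q : Fin N → ℂ[X]} (hg : Good p q) : (0 : ℝ) < Dtot p q := by
  obtain ⟨i, hi⟩ := hg.2.2.2
  have : degR p q i ≤ Dtot p q := Finset.single_le_sum (f := fun i => degR p q i) (fun _ _ => Nat.zero_le _) (Finset.mem_univ i)
  have h2 : 0 < Dtot p q := by omega
  exact_mod_cast h2

theorem Gm_le {p q : Fin N → ℂ[X]} (hg : Good p q) (f : SymX N → ℝ) (m : ℕ) (x : SymX N) (M δ : ℝ)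
    (h : ∀ y, (Tmap p q)^[m] y = x → f y ≤ M) (hy : ∃ y, (Tmap p q)^[m] y = x ∧ f y ≤ M - δ) :
    GmFun p q f m x ≤ M - δ / (Dtot p q : ℝ) ^ m := by
  obtain ⟨y, hy1, hy2⟩ := hy
  have hD := pow_pos (Dtot_pos hg) m
  have := sum_le_card_sub (preimTn p q m x) f M δ (fun y hy => h y ((mem_preimTn hg m x y).1 hy))
    ((mem_preimTn hg m x y).2 hy1) hy2
  rw [card_preimTn] at this
  push_cast at this
  rw [GmFun, inv_mul_le_iff₀ hD, mul_sub, mul_div_cancel₀ _ hD.ne']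
  exact this

theorem exists_preim {p q : Fin N → ℂ[X]} (hg : Good p q) (m : ℕ) (x : SymX N) :
    ∃ y, (Tmap p q)^[m] y = x := by
  have h1 : 0 < Multiset.card (preimTn p q m x) := by
    rw [card_preimTn]
    have := Dtot_pos hg
    have : 0 < Dtot p q := by exact_mod_cast this
    positivity
  obtain ⟨y, hy⟩ := Multiset.card_pos_iff_exists_mem.1 h1
  exact ⟨y, (mem_preimTn hg m x y).1 hy⟩

theorem Gm_neg (f : SymX N → ℝ) (m : ℕ) (x : SymX N) :
    GmFun p q (fun y => -f y) m x = - GmFun p q f m x := by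
  have key : ∀ s : Multiset (SymX N), (s.map fun y => -f y).sum = -(s.map f).sum := by
    intro s
    induction s using Multiset.induction_on with
    | empty => simp
    | cons a s ih =>
      rw [Multiset.map_cons, Multiset.sum_cons, Multiset.map_cons, Multiset.sum_cons, ih]
      ring
  rw [GmFun, GmFun, key]
  ring

theorem Gm_const {p q : Fin N → ℂ[X]} (hg : Good p q) (f : SymX N → ℝ) (m : ℕ) (x : SymX N) (c : ℝ)
    (h : ∀ y, (Tmap p q)^[m] y = x → f y = c) : GmFun p q f m x = c := by
  have hD := pow_pos (Dtot_pos hg) m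
  have : (preimTn p q m x).map f = (preimTn p q m x).map (fun _ => c) :=
    Multiset.map_congr rfl fun y hy => h y ((mem_preimTn hg m x y).1 hy)
  rw [GmFun, this, Multiset.map_const', Multiset.sum_replicate, card_preimTn, nsmul_eq_mul]
  push_cast
  field_simp

theorem supJ_bdd (h : C(↥(juliaSet p q), ℝ)) : BddAbove (Set.range fun x => |h x|) := by
  have : CompactSpace ↥(juliaSet p q) := isCompact_iff_compactSpace.1 (isCompact_julia p q)
  exact (isCompact_range (by fun_prop : Continuous fun x => |h x|)).bddAbove

theorem le_supJ (h : C(↥(juliaSet p q), ℝ)) (x : ↥(juliaSet p q)) : |h x| ≤ supJ p q ⇑h :=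
  le_ciSup (supJ_bdd p q h) x

theorem jextend_of_mem (h : ↥(juliaSet p q) → ℝ) {y : SymX N} (hy : y ∈ juliaSet p q) :
    jextend p q h y = h ⟨y, hy⟩ := by simp only [jextend, dif_pos hy]

theorem reach {p q : Fin N → ℂ[X]} (hg : Good p q) (hA1 : NoSuperAttract p q) (h : C(↥(juliaSet p q), ℝ))
    (V : Set ℝ) (hV : IsOpen V) (x1 : ↥(juliaSet p q)) (hx1 : h x1 ∈ V) :
    ∃ m0, ∀ m ≥ m0, ∀ x ∈ juliaSet p q, ∃ y, (Tmap p q)^[m] y = x ∧ jextend p q ⇑h y ∈ V := by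
  obtain ⟨U, hU, hUe⟩ := isOpen_induced_iff.1 (hV.preimage h.continuous)
  have hx1U : x1 ∈ Subtype.val ⁻¹' U := by rw [hUe]; exact hx1
  obtain ⟨m0, hm0⟩ := exactness hg hA1 U hU ⟨x1, hx1U, x1.2⟩
  refine ⟨m0, fun m hm x hx => ?_⟩
  obtain ⟨y, hyU, hy⟩ := hm0 m hm x hx
  have hyJ : y ∈ juliaSet p q := julia_back_iter hg m (by rw [hy]; exact hx)
  refine ⟨y, hy, ?_⟩
  rw [jextend_of_mem p q _ hyJ]
  have : (⟨y, hyJ⟩ : ↥(juliaSet p q)) ∈ Subtype.val ⁻¹' U := hyU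
  rw [hUe] at this
  exact this

theorem averaging_operator_norm
    (hg : Good p q) (hA1 : NoSuperAttract p q) :
    (∀ h : C(↥(juliaSet p q), ℝ), ∀ m : ℕ,
        supJ p q (fun x => GmFun p q (jextend p q ⇑h) m (x : SymX N)) ≤ supJ p q ⇑h) ∧
    (∀ m : ℕ, ∀ x : SymX N, GmFun p q (fun _ => (1 : ℝ)) m x = 1) ∧
    (∀ h : C(↥(juliaSet p q), ℝ),
        (∃ m₀ : ℕ, ∀ m ≥ m₀,
          supJ p q (fun x => GmFun p q (jextend p q ⇑h) m (x : SymX N)) < supJ p q ⇑h) ∨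
        ((∀ m : ℕ,
          supJ p q (fun x => GmFun p q (jextend p q ⇑h) m (x : SymX N)) = supJ p q ⇑h) ∧
          ∃ c : ℝ, ∀ x, h x = c)) := by
  have hup : ∀ (h : C(↥(juliaSet p q), ℝ)) (m : ℕ) (x : ↥(juliaSet p q)) (y : SymX N),
      (Tmap p q)^[m] y = x → |jextend p q ⇑h y| ≤ supJ p q ⇑h := by
    intro h m x y hy
    have hyJ : y ∈ juliaSet p q := julia_back_iter hg m (by rw [hy]; exact x.2)
    rw [jextend_of_mem p q _ hyJ]
    exact le_supJ p q h _
  refine ⟨?_, fun m x => Gm_const hg _ m x 1 fun _ _ => rfl, ?_⟩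
  · intro h m
    have h0 : 0 ≤ supJ p q ⇑h := Real.iSup_nonneg fun x => abs_nonneg _
    refine Real.iSup_le (fun x => ?_) h0
    obtain ⟨y, hy⟩ := exists_preim hg m (x : SymX N)
    rw [abs_le]
    constructor
    · have := Gm_le hg (fun y => - jextend p q ⇑h y) m x (supJ p q ⇑h) 0
        (fun y hy => (neg_le_abs _).trans (hup h m x y hy))
        ⟨y, hy, by rw [sub_zero]; exact (neg_le_abs _).trans (hup h m x y hy)⟩
      rw [Gm_neg, zero_div] at this
      linarith
    · have := Gm_le hg (jextend p q ⇑h) m x (supJ p q ⇑h) 0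
        (fun y hy => (le_abs_self _).trans (hup h m x y hy))
        ⟨y, hy, by rw [sub_zero]; exact (le_abs_self _).trans (hup h m x y hy)⟩
      rw [zero_div] at this
      linarith
  · intro h
    by_cases hc : ∃ c : ℝ, ∀ x, h x = c
    · right
      refine ⟨fun m => ?_, hc⟩
      obtain ⟨c, hc⟩ := hc
      congr 1
      funext x
      rw [hc x]
      refine Gm_const hg _ m _ c fun y hy => ?_
      have hyJ : y ∈ juliaSet p q := julia_back_iter hg m (by rw [hy]; exact x.2)
      rw [jextend_of_mem p q _ hyJ, hc]
    · left
      set M := supJ p q ⇑h with hM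
      have hne : Nonempty ↥(juliaSet p q) := by
        by_contra hn
        exact hc ⟨0, fun x => (hn ⟨x⟩).elim⟩
      obtain ⟨x1, hx1⟩ : ∃ x1, h x1 < M := by
        by_contra hn
        push Not at hn
        exact hc ⟨M, fun x => le_antisymm ((le_abs_self _).trans (le_supJ p q h x)) (hn x)⟩
      obtain ⟨x2, hx2⟩ : ∃ x2, -M < h x2 := by
        by_contra hn
        push Not at hn
        exact hc ⟨-M, fun x => le_antisymm (hn x) (neg_le_of_abs_le (le_supJ p q h x))⟩
      set δ := min ((M - h x1) / 2) ((h x2 + M) / 2) with hδ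
      have hδ0 : 0 < δ := lt_min (by linarith) (by linarith)
      have hδ1 : δ ≤ (M - h x1) / 2 := min_le_left _ _
      have hδ2 : δ ≤ (h x2 + M) / 2 := min_le_right _ _
      obtain ⟨m1, hm1⟩ := reach hg hA1 h (Set.Iio (M - δ)) isOpen_Iio x1 (by simp only [Set.mem_Iio]; linarith)
      obtain ⟨m2, hm2⟩ := reach hg hA1 h (Set.Ioi (-M + δ)) isOpen_Ioi x2 (by simp only [Set.mem_Ioi]; linarith)
      refine ⟨max m1 m2, fun m hm => ?_⟩
      have hD := pow_pos (Dtot_pos hg) m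
      have hpos : 0 < δ / (Dtot p q : ℝ) ^ m := by positivity
      refine lt_of_le_of_lt (ciSup_le (c := M - δ / (Dtot p q : ℝ) ^ m) fun x => ?_) (by linarith)
      rw [abs_le]
      constructor
      · obtain ⟨y, hy, hyV⟩ := hm2 m (le_trans (le_max_right _ _) hm) x x.2
        simp only [Set.mem_Ioi] at hyV
        have := Gm_le hg (fun y => - jextend p q ⇑h y) m x M δ
          (fun y hy => (neg_le_abs _).trans (hup h m x y hy)) ⟨y, hy, by linarith⟩
        rw [Gm_neg] at this
        linarith
      · obtain ⟨y, hy, hyV⟩ := hm1 m (le_trans (le_max_left _ _) hm) x x.2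
        simp only [Set.mem_Iio] at hyV
        exact Gm_le hg (jextend p q ⇑h) m x M δ
          (fun y hy => (le_abs_self _).trans (hup h m x y hy)) ⟨y, hy, by linarith⟩

end SkewRational
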